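/- arXiv:math/0611364 — 3 statements merged into one kernel-verified Lean document; each statement's English description precedes it below -/
import Mathlib

section
/- Let H be an infinite-dimensional Hilbert space, k a compact self-adjoint operator on H, and ε > 0. Then there exist a projection r in B(H) with r and 1−r both infinite-rank (r ∼ r⊥) and ‖k − rkr‖ < ε. -/
open Cardinal in
/-- A finite subset of an infinite type is contained in a subset equipotent to its complement. -/
theorem Set.Finite.exists_superset_equiv_compl {α : Type*} [Infinite α] {S : Set α}
    (hS : S.Finite) : ∃ T : Set α, S ⊆ T ∧ Nonempty (T ≃ (Tᶜ : Set α)) := by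
  obtain ⟨e⟩ : Nonempty (α ⊕ α ≃ α) := by
    rw [← Cardinal.eq, ← add_def, add_eq_self (aleph0_le_mk α)]
  refine ⟨S ∪ Set.range (e ∘ Sum.inl), Set.subset_union_left, ?_⟩
  rw [← Cardinal.eq]
  have hl : #α ≤ #(Set.range (e ∘ Sum.inl)) :=
    (mk_range_eq _ (e.injective.comp Sum.inl_injective)).ge
  have hr : #(Set.range (e ∘ Sum.inr)) = #α :=
    mk_range_eq _ (e.injective.comp Sum.inr_injective)
  have hT : #(S ∪ Set.range (e ∘ Sum.inl) : Set α) = #α :=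
    (mk_set_le _).antisymm (hl.trans (mk_le_mk_of_subset Set.subset_union_right))
  have hsub : Set.range (e ∘ Sum.inr) ⊆ (S ∪ Set.range (e ∘ Sum.inl))ᶜ ∪ S := by
    rintro _ ⟨a, rfl⟩
    by_cases h : e (Sum.inr a) ∈ S
    · exact Or.inr h
    · refine Or.inl ?_
      rintro (h' | ⟨b, hb⟩)
      · exact h h'
      · simpa using e.injective hb
  have hle : #α ≤ #((S ∪ Set.range (e ∘ Sum.inl))ᶜ : Set α) + #S :=
    hr.ge.trans ((mk_le_mk_of_subset hsub).trans (mk_union_le _ _))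
  rw [hT]
  refine le_antisymm ?_ (mk_set_le _)
  by_contra! hlt
  exact absurd hle (not_le.2 (add_lt_of_lt (aleph0_le_mk α) hlt
    (hS.lt_aleph0.trans_le (aleph0_le_mk α))))

/-- An equivalence between a set and its complement extends to a permutation exchanging them. -/
theorem Equiv.exists_perm_mem_iff_notMem {α : Type*} {T : Set α} (e : T ≃ (Tᶜ : Set α)) :
    ∃ σ : Equiv.Perm α, ∀ i, σ i ∈ T ↔ i ∉ T := by
  classical
  refine ⟨(Equiv.Set.sumCompl T).symm.trans ((Equiv.sumCongr e e.symm).trans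
    ((Equiv.sumComm _ _).trans (Equiv.Set.sumCompl T))), fun i => ?_⟩
  by_cases hi : i ∈ T
  · have he : (e ⟨i, hi⟩ : α) ∉ T := (e ⟨i, hi⟩).2
    simp [Equiv.Set.sumCompl_symm_apply_of_mem hi, hi, he]
  · simp [Equiv.Set.sumCompl_symm_apply_of_notMem hi, hi]

section

variable {𝕜 E : Type*} [RCLike 𝕜] [NormedAddCommGroup E] [InnerProductSpace 𝕜 E]

/-- A compact operator is almost unchanged by composition with the orthogonal projection onto any
subspace containing a suitable finite set. -/
theorem IsCompactOperator.exists_finite_norm_sub_starProjection_mul_le {k : E →L[𝕜] E}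
    (hk : IsCompactOperator k) {δ : ℝ} (hδ : 0 < δ) :
    ∃ t : Set E, t.Finite ∧ ∀ (K : Submodule 𝕜 E) [K.HasOrthogonalProjection],
      t ⊆ K → ‖k - K.starProjection * k‖ ≤ δ := by
  have hc := hk.isCompact_closure_image_closedBall (f := (k : E →ₗ[𝕜] E)) 1
  obtain ⟨t, ht, hcover⟩ := Metric.totallyBounded_iff.1 hc.totallyBounded δ hδ
  refine ⟨t, ht, fun K _ htK => ?_⟩
  refine ContinuousLinearMap.opNorm_le_of_unit_norm hδ.le fun x hx => ?_
  have hx' : k x ∈ closure ((k : E →ₗ[𝕜] E) '' Metric.closedBall 0 1) :=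
    subset_closure ⟨x, by simp [hx], rfl⟩
  obtain ⟨y, hy, hxy⟩ := Set.mem_iUnion₂.1 (hcover hx')
  calc ‖(k - K.starProjection * k) x‖ = ‖k x - K.starProjection (k x)‖ := rfl
    _ = ⨅ z : K, ‖k x - z‖ := Submodule.starProjection_minimal _
    _ ≤ ‖k x - y‖ := ciInf_le ⟨0, by rintro _ ⟨z, rfl⟩; positivity⟩ (⟨y, htK hy⟩ : K)
    _ ≤ δ := (mem_ball_iff_norm.1 hxy).le

/-- Compressing a self-adjoint operator by a projection `p` costs at most twice as much as
multiplying by `p` on one side. -/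
theorem IsStarProjection.norm_sub_conj_le [CompleteSpace E] {k p : E →L[𝕜] E}
    (hp : IsStarProjection p) (hk : IsSelfAdjoint k) :
    ‖k - p * k * p‖ ≤ 2 * ‖k - p * k‖ := by
  have hstar : ‖k - k * p‖ = ‖k - p * k‖ := by
    rw [← norm_star (k - p * k), star_sub, star_mul, hk.star_eq, hp.isSelfAdjoint.star_eq]
  have hp1 : ‖p‖ ≤ 1 := hp.norm_le
  calc ‖k - p * k * p‖ = ‖(k - p * k) + p * (k - k * p)‖ := by congr 1; noncomm_ring
    _ ≤ ‖k - p * k‖ + ‖p‖ * ‖k - k * p‖ :=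
        (norm_add_le _ _).trans (by gcongr; exact norm_mul_le _ _)
    _ ≤ ‖k - p * k‖ + 1 * ‖k - p * k‖ := by rw [hstar]; gcongr
    _ = 2 * ‖k - p * k‖ := by ring

/-- Any finite set lies in the span of finitely many vectors of some Hilbert basis. -/
theorem Set.Finite.exists_hilbertBasis_subset_span [CompleteSpace E] {t : Set E}
    (ht : t.Finite) : ∃ (w : Set E) (b : HilbertBasis w 𝕜 E) (S : Set w), S.Finite ∧
      t ⊆ Submodule.span 𝕜 (b '' S) := by
  have : FiniteDimensional 𝕜 (Submodule.span 𝕜 t) := FiniteDimensional.span_of_finite 𝕜 ht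
  let c := stdOrthonormalBasis 𝕜 (Submodule.span 𝕜 t)
  let v : Fin _ → E := fun i => (c i : E)
  have hv : Orthonormal 𝕜 v := c.orthonormal.comp_linearIsometry (Submodule.subtypeₗᵢ _)
  obtain ⟨w, b, hw, hb⟩ := hv.toSubtypeRange.exists_hilbertBasis_extension
  refine ⟨w, b, (↑) ⁻¹' Set.range v,
    (Set.finite_range v).preimage Subtype.val_injective.injOn, ?_⟩
  rw [hb, Subtype.image_preimage_coe, Set.inter_eq_right.2 hw]
  have hspan : Submodule.span 𝕜 (Set.range v) = Submodule.span 𝕜 t := by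
    have := congrArg (Submodule.map (Submodule.span 𝕜 t).subtype) c.toBasis.span_eq
    rw [Submodule.map_span, ← Set.range_comp, Submodule.map_top, Submodule.range_subtype] at this
    refine Eq.trans (congrArg _ (congrArg _ ?_)) this
    ext i
    simp [v]
  rw [hspan]
  exact Submodule.subset_span

namespace HilbertBasis

variable {ι : Type*}

theorem infinite_of_not_finiteDimensional (b : HilbertBasis ι 𝕜 E)
    (h : ¬ FiniteDimensional 𝕜 E) : Infinite ι := by
  refine not_finite_iff_infinite.1 fun hι => h ?_
  have hfd : FiniteDimensional 𝕜 (Submodule.span 𝕜 (Set.range b)) :=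
    FiniteDimensional.span_of_finite 𝕜 (Set.finite_range b)
  have htop : Submodule.span 𝕜 (Set.range b) = ⊤ := by
    rw [← b.dense_span]
    exact (Submodule.closed_of_finiteDimensional _).submodule_topologicalClosure_eq.symm
  rw [htop] at hfd
  exact Module.finite_def.2 (Module.Finite.iff_fg.1 hfd)

/-- A continuous linear map is determined by its values on a Hilbert basis. -/
theorem ext_clm (b : HilbertBasis ι 𝕜 E) {f g : E →L[𝕜] E} (h : ∀ i, f (b i) = g (b i)) :
    f = g := by
  refine ContinuousLinearMap.ext_on (s := Set.range b) ?_ ?_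
  · exact Submodule.dense_iff_topologicalClosure_eq_top.2 b.dense_span
  · rintro _ ⟨i, rfl⟩
    exact h i

/-- A permutation of a Hilbert basis is implemented by a unitary operator. -/
theorem exists_unitary_apply_eq [CompleteSpace E] (b : HilbertBasis ι 𝕜 E)
    (σ : Equiv.Perm ι) : ∃ u ∈ unitary (E →L[𝕜] E), ∀ i, u (b i) = b (σ i) := by
  classical
  let b' := HilbertBasis.mk (b.orthonormal.comp σ σ.injective)
    (by rw [σ.surjective.range_comp, b.dense_span])
  let e : E ≃ₗᵢ[𝕜] E := b.repr.trans b'.repr.symm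
  refine ⟨Unitary.linearIsometryEquiv.symm e, SetLike.coe_mem _, fun i => ?_⟩
  change b'.repr.symm (b.repr (b i)) = _
  rw [b.repr_self, b'.repr_symm_single, HilbertBasis.coe_mk]
  rfl

/-- An operator fixing infinitely many vectors of a Hilbert basis has infinite rank. -/
theorem not_finiteDimensional_range (b : HilbertBasis ι 𝕜 E) {T : Set ι} [Infinite T]
    {f : E →L[𝕜] E} (hf : ∀ i ∈ T, f (b i) = b i) :
    ¬ FiniteDimensional 𝕜 (LinearMap.range (f : E →ₗ[𝕜] E)) := by
  intro hfd
  let v : T → LinearMap.range (f : E →ₗ[𝕜] E) := fun i => ⟨b i, b i, hf i i.2⟩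
  refine Module.Finite.not_linearIndependent_of_infinite (R := 𝕜) v ?_
  refine LinearIndependent.of_comp (LinearMap.range (f : E →ₗ[𝕜] E)).subtype ?_
  exact b.orthonormal.linearIndependent.comp _ Subtype.val_injective

end HilbertBasis

end

/-- If `k` is a compact self-adjoint operator on an infinite-dimensional Hilbert
space and `ε > 0`, there is a projection `r` with both `r` and `1 − r` of infinite rank
(indeed `r ∼ 1 − r`) such that `‖k − rkr‖ < ε`. -/
theorem stmt8 {H : Type*} [NormedAddCommGroup H] [InnerProductSpace ℂ H] [CompleteSpace H]
    (hinf : ¬ FiniteDimensional ℂ H)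
    (k : H →L[ℂ] H) (hk : IsCompactOperator k) (hksa : IsSelfAdjoint k)
    (ε : ℝ) (hε : 0 < ε) :
    ∃ r : H →L[ℂ] H, IsSelfAdjoint r ∧ IsIdempotentElem r ∧
      ¬ FiniteDimensional ℂ (LinearMap.range (r : H →ₗ[ℂ] H)) ∧
      ¬ FiniteDimensional ℂ (LinearMap.range ((1 - r : H →L[ℂ] H) : H →ₗ[ℂ] H)) ∧
      (∃ v : H →L[ℂ] H, star v * v = r ∧ v * star v = 1 - r) ∧
      ‖k - r * k * r‖ < ε := by
  obtain ⟨t, ht, hkt⟩ :=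
    hk.exists_finite_norm_sub_starProjection_mul_le (δ := ε / 3) (by positivity)
  obtain ⟨w, b, S, hS, htS⟩ := ht.exists_hilbertBasis_subset_span (𝕜 := ℂ)
  have := b.infinite_of_not_finiteDimensional hinf
  obtain ⟨T, hST, ⟨e⟩⟩ := hS.exists_superset_equiv_compl
  have hT : Infinite T := by
    classical
    by_contra hfin
    rw [not_infinite_iff_finite] at hfin
    have := Finite.of_equiv T e
    exact not_finite_iff_infinite.2 ‹_› (Finite.of_equiv _ (Equiv.Set.sumCompl T))
  have hTc : Infinite (Tᶜ : Set w) := e.infinite_iff.1 hT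
  let K := (Submodule.span ℂ (b '' T)).topologicalClosure
  set r := K.starProjection with hr
  have hrp : IsStarProjection r := isStarProjection_starProjection
  have hr_mem : ∀ i ∈ T, r (b i) = b i := fun i hi =>
    Submodule.starProjection_eq_self_iff.2
      (Submodule.le_topologicalClosure _ (Submodule.subset_span ⟨i, hi, rfl⟩))
  have hr_notMem : ∀ i ∉ T, r (b i) = 0 := fun i hi => by
    rw [hr, Submodule.starProjection_apply_eq_zero_iff, Submodule.orthogonal_closure,
      Submodule.mem_orthogonal]
    intro x hx
    induction hx using Submodule.span_induction with
    | mem x hx =>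
      obtain ⟨j, hj, rfl⟩ := hx
      exact b.orthonormal.2 fun hji => hi (hji ▸ hj)
    | zero => simp
    | add x y _ _ hx hy => rw [inner_add_left, hx, hy, add_zero]
    | smul c x _ hx => rw [inner_smul_left, hx, mul_zero]
  obtain ⟨σ, hσ⟩ := e.exists_perm_mem_iff_notMem
  obtain ⟨u, hu, hub⟩ := b.exists_unitary_apply_eq σ
  have hur : u * r = (1 - r) * u := b.ext_clm fun i => by
    by_cases hi : i ∈ T
    · simp [hub, hr_mem i hi, hr_notMem (σ i) (by simpa [hσ] using hi)]
    · simp [hub, hr_notMem i hi, hr_mem (σ i) ((hσ i).2 hi)]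
  refine ⟨r, hrp.isSelfAdjoint, hrp.isIdempotentElem, b.not_finiteDimensional_range hr_mem,
    b.not_finiteDimensional_range (T := Tᶜ) fun i hi => by simp [hr_notMem i hi],
    ⟨u * r, ?_, ?_⟩, ?_⟩
  · rw [star_mul, hrp.isSelfAdjoint.star_eq, mul_assoc, ← mul_assoc (star u),
      Unitary.star_mul_self_of_mem hu, one_mul, hrp.isIdempotentElem.eq]
  · rw [star_mul, hrp.isSelfAdjoint.star_eq, mul_assoc, ← mul_assoc r,
      hrp.isIdempotentElem.eq, ← mul_assoc, hur, mul_assoc, Unitary.mul_star_self_of_mem hu,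
      mul_one]
  · have hle := hkt K fun x hx => Submodule.le_topologicalClosure _
      (Submodule.span_mono (Set.image_mono hST) (htS hx))
    linarith [hrp.norm_sub_conj_le hksa]
end

section
/- For any bounded operator x on ℓ² and any ε > 0 there exists y ∈ B(ℓ²) with ‖y − x‖ < ε such that the unital C*-algebra generated by y contains a rank one projection. -/
open Filter Topology InnerProductSpace

/-- If `‖t‖ < 1` and the idempotent `p` annihilates `t` on both sides, then the powers of `t + p`
converge to `p`. -/
theorem tendsto_add_pow_of_annihilates {A : Type*} [NormedRing A] {t p : A} (ht : ‖t‖ < 1)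
    (hp : IsIdempotentElem p) (htp : t * p = 0) (hpt : p * t = 0) :
    Tendsto (fun n : ℕ => (t + p) ^ (n + 1)) atTop (𝓝 p) := by
  have hpow (n : ℕ) : (t + p) ^ (n + 1) = t ^ (n + 1) + p := by
    induction n with
    | zero => simp
    | succ n ih =>
      rw [pow_succ, ih, add_mul, mul_add, mul_add, pow_succ t n, mul_assoc _ t p, htp, hpt, hp.eq,
        pow_succ t (n + 1), pow_succ t n]
      simp
  simp_rw [hpow]
  simpa using ((tendsto_add_atTop_iff_nat 1).2
    (tendsto_pow_atTop_nhds_zero_of_norm_lt_one ht)).add_const p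

section

variable {H : Type*} [NormedAddCommGroup H] [InnerProductSpace ℂ H] [CompleteSpace H]

/-- A self-adjoint operator which is not invertible is not bounded below. -/
theorem IsSelfAdjoint.exists_norm_eq_one_norm_apply_lt {d : H →L[ℂ] H} (hd : IsSelfAdjoint d)
    (hu : ¬ IsUnit d) {δ : ℝ} (hδ : 0 < δ) : ∃ v : H, ‖v‖ = 1 ∧ ‖d v‖ < δ := by
  by_contra! h
  have hbound (v : H) : δ * ‖v‖ ≤ ‖d v‖ := by
    rcases eq_or_ne v 0 with rfl | hv
    · simp
    have hv' : 0 < ‖v‖ := norm_pos_iff.2 hv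
    have := h (((‖v‖⁻¹ : ℝ) : ℂ) • v) (by
      rw [norm_smul, Complex.norm_real, norm_inv, norm_norm, inv_mul_cancel₀ hv'.ne'])
    rw [map_smul, norm_smul, Complex.norm_real, norm_inv, norm_norm] at this
    rwa [inv_mul_eq_div, le_div_iff₀ hv'] at this
  refine hu (isUnit_pow_iff two_ne_zero |>.1 <|
    ContinuousLinearMap.isUnit_of_forall_le_norm_inner_map (d ^ 2) (c := (δ ^ 2).toNNReal)
      (Real.toNNReal_pos.2 (by positivity)) fun v => ?_)
  have hinner : inner ℂ ((d ^ 2) v) v = inner ℂ (d v) (d v) := by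
    rw [pow_two, mul_apply_eq_comp]
    exact hd.isSymmetric (d v) v
  rw [hinner, inner_self_eq_norm_sq_to_K, Real.coe_toNNReal _ (by positivity)]
  have := pow_le_pow_left₀ (by positivity) (hbound v) 2
  simpa [mul_pow, mul_comm] using this

/-- A positive operator `c` has an arbitrarily small self-adjoint perturbation for which some
rank one projection is a limit of powers of a scalar multiple. -/
theorem exists_perturbation_of_nonneg [Nontrivial H] {c : H →L[ℂ] H} (hc : 0 ≤ c) {ε : ℝ}
    (hε : 0 < ε) :
    ∃ (k : H →L[ℂ] H) (v : H) (r : ℝ), IsSelfAdjoint k ∧ ‖k‖ < ε ∧ ‖v‖ = 1 ∧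
      Tendsto (fun n : ℕ => ((r : ℂ) • (c + k)) ^ (n + 1)) atTop (𝓝 (rankOne ℂ v v)) := by
  have hcs : IsSelfAdjoint c := .of_nonneg hc
  set M : ℝ := ‖c‖
  set d : H →L[ℂ] H := c - algebraMap ℝ (H →L[ℂ] H) M with hd
  have hds : IsSelfAdjoint d := hcs.sub (.algebraMap _ (.all M))
  have hdu : ¬ IsUnit d := by
    have := CStarAlgebra.norm_mem_spectrum_of_nonneg (a := c)
    rwa [spectrum.mem_iff, ← IsUnit.neg_iff, neg_sub] at this
  obtain ⟨v, hv, hdv⟩ := hds.exists_norm_eq_one_norm_apply_lt hdu (show 0 < ε / 8 by positivity)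
  set p : H →L[ℂ] H := rankOne ℂ v v
  have hp : IsStarProjection p := isStarProjection_rankOne_self hv
  have hpn : ‖p‖ = 1 := by simp [p, hv]
  have hdp : ‖d * p‖ < ε / 8 := by
    have : d * p = rankOne ℂ (d v) v := comp_rankOne ..
    rwa [this, norm_rankOne, hv, mul_one]
  have hpd : ‖p * d‖ < ε / 8 := by
    rwa [← norm_star, star_mul, hds.star_eq, hp.isSelfAdjoint.star_eq]
  have hpdp : ‖p * d * p‖ < ε / 8 :=
    (norm_mul_le _ _).trans_lt (by rwa [hpn, mul_one])
  set μ : ℝ := M + ε / 4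
  have hμ : 0 < μ := by positivity
  set Q : H →L[ℂ] H := (1 - p) * c * (1 - p) with hQ
  have hQp : Q * p = 0 := by rw [hQ, mul_assoc, sub_mul 1 p p, hp.isIdempotentElem.eq]; simp
  have hpQ : p * Q = 0 := by
    rw [hQ, mul_assoc, ← mul_assoc, mul_sub, hp.isIdempotentElem.eq]; simp
  have hQn : ‖Q‖ ≤ M := by
    have h1 : ‖1 - p‖ ≤ 1 := hp.one_sub.norm_le
    calc ‖Q‖ ≤ ‖1 - p‖ * ‖c‖ * ‖1 - p‖ := norm_mul₃_le
      _ ≤ 1 * ‖c‖ * 1 := by gcongr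
      _ = M := by simp [M]
  have hk : Q + (μ : ℂ) • p - c = p * d * p - p * d - d * p + ((ε / 4 : ℝ) : ℂ) • p := by
    have hcd : c = d + (M : ℂ) • (1 : H →L[ℂ] H) := by
      rw [hd, Algebra.algebraMap_eq_smul_one, Complex.coe_smul]; abel
    have hpp := hp.isIdempotentElem.eq
    rw [hQ, hcd]
    simp only [sub_mul, mul_sub, add_mul, mul_add, one_mul, mul_one, smul_mul_assoc,
      mul_smul_comm, hpp, μ, Complex.ofReal_add, add_smul]
    module
  refine ⟨Q + (μ : ℂ) • p - c, v, μ⁻¹, ?_, ?_, hv, ?_⟩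
  · have hμs : IsSelfAdjoint (μ : ℂ) := Complex.conj_ofReal μ
    refine ((?_ : IsSelfAdjoint Q).add (hμs.smul hp.isSelfAdjoint)).sub hcs
    have := hcs.conjugate (1 - p)
    rwa [hp.one_sub.isSelfAdjoint.star_eq] at this
  · rw [hk]
    have hsmul : ‖((ε / 4 : ℝ) : ℂ) • p‖ = ε / 4 := by
      rw [norm_smul, hpn, Complex.norm_real, mul_one, Real.norm_of_nonneg (by positivity)]
    have h1 := norm_add_le (p * d * p - p * d - d * p) (((ε / 4 : ℝ) : ℂ) • p)
    have h2 := norm_sub_le (p * d * p - p * d) (d * p)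
    have h3 := norm_sub_le (p * d * p) (p * d)
    linarith
  · have hμc : ((μ⁻¹ : ℝ) : ℂ) * (μ : ℂ) = 1 := by
      rw [← Complex.ofReal_mul, inv_mul_cancel₀ hμ.ne', Complex.ofReal_one]
    rw [add_sub_cancel, smul_add, smul_smul, hμc, one_smul]
    refine tendsto_add_pow_of_annihilates ?_ hp.isIdempotentElem
      (by rw [smul_mul_assoc, hQp, smul_zero]) (by rw [mul_smul_comm, hpQ, smul_zero])
    rw [norm_smul, Complex.norm_real, norm_inv, Real.norm_of_nonneg hμ.le, inv_mul_eq_div,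
      div_lt_one hμ]
    linarith [show M < μ from lt_add_of_pos_right _ (by positivity)]

/-- Every bounded operator on a nontrivial Hilbert space has an arbitrarily small perturbation
generating a unital C⋆-algebra that contains a rank one projection. -/
theorem exists_rankOne_mem_elemental [Nontrivial H] (x : H →L[ℂ] H) {ε : ℝ} (hε : 0 < ε) :
    ∃ (y : H →L[ℂ] H) (v : H), ‖y - x‖ < ε ∧ ‖v‖ = 1 ∧
      rankOne ℂ v v ∈ StarAlgebra.elemental ℂ y := by
  set a : H →L[ℂ] H := (realPart x : H →L[ℂ] H)
  set s : H →L[ℂ] H := algebraMap ℝ (H →L[ℂ] H) ‖a‖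
  have hc : 0 ≤ a + s := by
    have := (realPart x).2.neg_algebraMap_norm_le_self
    rwa [neg_le_iff_add_nonneg] at this
  obtain ⟨k, v, r, hks, hkn, hv, hlim⟩ := exists_perturbation_of_nonneg hc hε
  refine ⟨x + k, v, by simpa using hkn, hv, ?_⟩
  have hre : (realPart (x + k) : H →L[ℂ] H) = a + k := by
    rw [map_add, AddSubgroup.coe_add, hks.coe_realPart]
  have hs_mem : s ∈ StarAlgebra.elemental ℂ (x + k) := by
    have := (StarAlgebra.elemental ℂ (x + k)).algebraMap_mem (‖a‖ : ℂ)
    rwa [Algebra.algebraMap_eq_smul_one, Complex.coe_smul, ← Algebra.algebraMap_eq_smul_one]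
      at this
  have hre_mem : a + k ∈ StarAlgebra.elemental ℂ (x + k) := by
    rw [← hre, realPart_apply_coe, ← Complex.coe_smul]
    exact SMulMemClass.smul_mem _ (add_mem (StarAlgebra.elemental.self_mem ℂ _)
      (StarAlgebra.elemental.star_self_mem ℂ _))
  refine (StarAlgebra.elemental.isClosed ℂ (x + k)).mem_of_tendsto hlim
    (Eventually.of_forall fun n => pow_mem (SMulMemClass.smul_mem _ ?_) _)
  rw [add_right_comm]
  exact add_mem hre_mem hs_mem

end

/-- The range of `rankOne ℂ v v` has dimension one for a nonzero `v`. -/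
theorem finrank_range_rankOne_self {H : Type*} [NormedAddCommGroup H]
    [InnerProductSpace ℂ H] {v : H} (hv : v ≠ 0) :
    Module.finrank ℂ (LinearMap.range (rankOne ℂ v v : H →ₗ[ℂ] H)) = 1 := by
  exact Module.rank_eq_one_iff_finrank_eq_one.1 (rank_rankOne hv hv)

/-- For any bounded operator `x` on `ℓ²` and `ε > 0`, there is `y` with
`‖y − x‖ < ε` such that the unital C*-algebra generated by `y` contains a rank-one
projection. -/
theorem stmt11 (x : lp (fun _ : ℕ => ℂ) 2 →L[ℂ] lp (fun _ : ℕ => ℂ) 2)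
    (ε : ℝ) (hε : 0 < ε) :
    ∃ y p : lp (fun _ : ℕ => ℂ) 2 →L[ℂ] lp (fun _ : ℕ => ℂ) 2,
      ‖y - x‖ < ε ∧ p ∈ StarAlgebra.elemental ℂ y ∧
      IsSelfAdjoint p ∧ IsIdempotentElem p ∧
      Module.finrank ℂ
        (LinearMap.range (p : lp (fun _ : ℕ => ℂ) 2 →ₗ[ℂ] lp (fun _ : ℕ => ℂ) 2)) = 1 ∧
      FiniteDimensional ℂ
        (LinearMap.range (p : lp (fun _ : ℕ => ℂ) 2 →ₗ[ℂ] lp (fun _ : ℕ => ℂ) 2)) := by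
  have : Nontrivial (lp (fun _ : ℕ => ℂ) 2) :=
    ⟨⟨lp.single 2 0 1, 0, fun h => by simpa using congrArg norm h⟩⟩
  obtain ⟨y, v, hy, hv, hmem⟩ := exists_rankOne_mem_elemental x hε
  have hp := isStarProjection_rankOne_self (𝕜 := ℂ) hv
  have hfin := finrank_range_rankOne_self (v := v) (by rintro rfl; simp at hv)
  exact ⟨y, rankOne ℂ v v, hy, hmem, hp.isSelfAdjoint, hp.isIdempotentElem, hfin,
    Module.finite_of_finrank_eq_succ hfin⟩
end

section
/- (Cancellation for finite amplifications.) Let M and N be von Neumann algebras, x ∈ M, y ∈ N, and n a finite cardinal ≥ 2. If there is a *-isomorphism π : M_n(ℂ) ⊗̄ M → M_n(ℂ) ⊗̄ N carrying 1 ⊗ x to 1 ⊗ y, then there is a *-isomorphism M → N carrying x to y. In particular M_n ⊗̄ M ≅ M_n ⊗̄ N implies M ≅ N. -/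
/-- A star ring sharing the features of a von Neumann algebra on which the comparison theory of
projections rests: a proper involution, support projections, polar decomposition, and maximal
partial isometries between two projections. -/
structure IsComparable (R : Type*) [Ring R] [StarRing R] : Prop where
  proper : ∀ a : R, star a * a = 0 → a = 0
  support : ∀ X : Set R, ∃ b : R, IsStarProjection b ∧ ∀ a, a * b = 0 ↔ ∀ x ∈ X, a * x = 0
  polar : ∀ t : R, ∃ v : R, v * star v * v = v ∧ (∀ a, t * a = 0 ↔ v * a = 0) ∧
    ∀ a, star t * a = 0 ↔ star v * a = 0
  maximal : ∀ p q : R, IsStarProjection p → IsStarProjection q →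
    ∃ v : R, v * star v * v = v ∧ v * p = v ∧ q * v = v ∧
      ∀ t, (q - v * star v) * t * (p - star v * v) = 0

/-- `a * b = c` in a form that rewrites inside right-associated products. -/
theorem mul_mul_of_mul_eq {R : Type*} [Semigroup R] {a b c : R} (h : a * b = c) (x : R) :
    a * (b * x) = c * x := by
  rw [← mul_assoc, h]

/-- `r` is equivalent to infinitely many orthogonal subprojections of `A`: `w` embeds `r` in `A`
and `s` shifts the range of `w` through `A`. -/
structure IsShift {R : Type*} [Ring R] [StarRing R] (r A w s : R) : Prop where
  star_mul_self : star w * w = r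
  base_isometry : w * star w * w = w
  mul_base : A * w = w
  mul_shift : A * s = s
  star_mul_base : star s * w = 0
  star_mul_shift : star s * s = w * star w + s * star s
  isometry : s * star s * s = s

namespace IsComparable

variable {R : Type*} [Ring R] [StarRing R]

theorem mul_of_star_mul_self (hR : IsComparable R) {w r : R} (hr : IsStarProjection r)
    (h : star w * w = r) : w * r = w := by
  have h1 := hr.isIdempotentElem.eq
  have h2 := hr.isSelfAdjoint.star_eq
  have h3 : w * r - w = 0 := by
    apply hR.proper
    simp only [star_sub, star_mul, h2, sub_mul, mul_sub, mul_assoc, h, h1, mul_mul_of_mul_eq h]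
    simp
  exact sub_eq_zero.mp h3

theorem exists_comparison (hR : IsComparable R) {p q : R} (hp : IsStarProjection p)
    (hq : IsStarProjection q) :
    ∃ v z : R, IsStarProjection z ∧ (∀ a, a * z = z * a) ∧ v * star v * v = v ∧ v * p = v ∧
      q * v = v ∧ z * (star v * v) = z * p ∧ (1 - z) * (v * star v) = (1 - z) * q := by
  obtain ⟨v, hv, hvp, hqv, h⟩ := hR.maximal p q hp hq
  obtain ⟨z, hz, hz'⟩ := hR.support {x | ∃ t, x = t * (p - star v * v)}
  have h1 : ∀ a, (1 - z) * a * z = 0 := fun a => by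
    rw [hz']
    rintro x ⟨t, rfl⟩
    have := (hz' (1 - z)).1 (by rw [sub_mul, one_mul, hz.isIdempotentElem.eq, sub_self])
      (a * t * (p - star v * v)) ⟨_, rfl⟩
    simpa only [mul_assoc] using this
  have h2 : ∀ a, a * z = z * a := fun a => by
    have e1 := h1 a
    have e2 := congrArg star (h1 (star a))
    simp only [star_mul, star_sub, star_one, hz.isSelfAdjoint.star_eq, star_star, star_zero] at e2
    simp only [sub_mul, mul_sub, one_mul, mul_one, ← mul_assoc, sub_eq_zero] at e1 e2
    rw [e1, ← e2]
  have h3 : (1 - z) * (p - star v * v) = 0 :=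
    (hz' (1 - z)).1 (by rw [sub_mul, one_mul, hz.isIdempotentElem.eq, sub_self]) _
      ⟨1, (one_mul _).symm⟩
  have h4 : (q - v * star v) * z = 0 := by
    rw [hz']
    rintro x ⟨t, rfl⟩
    rw [← mul_assoc]
    exact h t
  refine ⟨v, 1 - z, hz.one_sub, fun a => ?_, hv, hvp, hqv, ?_, ?_⟩
  · rw [mul_sub, sub_mul, h2, mul_one, one_mul]
  · rw [mul_sub, sub_eq_zero] at h3
    exact h3.symm
  · rw [h2, mul_sub, sub_eq_zero] at h4
    rw [sub_sub_cancel]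
    exact h4.symm

/-- A partial isometry `v` with the supports of `p * q`, where the remainders `q - v⋆v` and
`p - vv⋆` are identified as the meets of `q` with `1 - p` and of `p` with `1 - q`. -/
theorem exists_polar_mul (hR : IsComparable R) {p q : R} (hp : IsStarProjection p)
    (hq : IsStarProjection q) :
    ∃ v : R, v * star v * v = v ∧ v * q = v ∧ p * v = v ∧
      IsStarProjection (q - star v * v) ∧ (∀ a, (q - star v * v) * a = a ↔ q * a = a ∧ p * a = 0) ∧
      IsStarProjection (p - v * star v) ∧
      ∀ a, (p - v * star v) * a = a ↔ p * a = a ∧ q * a = 0 := by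
  have hpp := hp.isIdempotentElem.eq
  have hqq := hq.isIdempotentElem.eq
  have hps := hp.isSelfAdjoint.star_eq
  have hqs := hq.isSelfAdjoint.star_eq
  obtain ⟨v, h1, h2, h3⟩ := hR.polar (p * q)
  rw [star_mul, hps, hqs] at h3
  have h4 : v * q = v := by
    have := (h2 (1 - q)).1 (by rw [mul_assoc, hq.mul_one_sub_self, mul_zero])
    rw [mul_sub, mul_one, sub_eq_zero] at this
    exact this.symm
  have h5 : star v * p = star v := by
    have := (h3 (1 - p)).1 (by rw [mul_assoc, hp.mul_one_sub_self, mul_zero])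
    rw [mul_sub, mul_one, sub_eq_zero] at this
    exact this.symm
  have h6 : p * v = v := by simpa [hps] using congrArg star h5
  have h7 : q * star v = star v := by simpa [hqs] using congrArg star h4
  have h8 : star v * v * star v = star v := by simpa [mul_assoc] using congrArg star h1
  refine ⟨v, h1, h4, h6, ⟨?_, by simp [IsSelfAdjoint, hqs]⟩, fun a => ⟨fun h => ?_, fun h => ?_⟩,
    ⟨?_, by simp [IsSelfAdjoint, hps]⟩, fun a => ⟨fun h => ?_, fun h => ?_⟩⟩
  · simp only [IsIdempotentElem, sub_mul, mul_sub]
    grind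
  · have e1 : q * a = a := by
      rw [← h]
      simp only [sub_mul, mul_sub]
      grind
    have e2 : v * a = 0 := by
      rw [← h]
      simp only [sub_mul, mul_sub]
      grind
    have e3 := (h2 a).2 e2
    grind
  · have e2 := (h2 a).1 (by rw [mul_assoc, h.1, h.2])
    rw [sub_mul, mul_assoc, e2, mul_zero, sub_zero, h.1]
  · simp only [IsIdempotentElem, sub_mul, mul_sub]
    grind
  · have e1 : p * a = a := by
      rw [← h]
      simp only [sub_mul, mul_sub]
      grind
    have e2 : star v * a = 0 := by
      rw [← h]
      simp only [sub_mul, mul_sub]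
      grind
    have e3 := (h3 a).2 e2
    grind
  · have e2 := (h3 a).1 (by rw [mul_assoc, h.1, h.2])
    rw [sub_mul, mul_assoc, e2, mul_zero, sub_zero, h.1]

theorem _root_.IsStarProjection.eq_of_forall_mul_eq_iff {p q : R} (hp : IsStarProjection p)
    (hq : IsStarProjection q) (h : ∀ a, p * a = a ↔ q * a = a) : p = q := by
  have h1 := (h p).1 hp.isIdempotentElem.eq
  have h2 := congrArg star ((h q).2 hq.isIdempotentElem.eq)
  rw [star_mul, hp.isSelfAdjoint.star_eq, hq.isSelfAdjoint.star_eq] at h2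
  rw [← h1, h2]

/-- For orthogonal decompositions `e + f = g + g'` of a projection, a central projection `z`
embeds `g` in `f` on `z` and `g'` in `e` on `1 - z`. -/
theorem exists_dichotomy (hR : IsComparable R) {e f g : R} (he : IsStarProjection e)
    (hf : IsStarProjection f) (hef : e * f = 0) (hg : IsStarProjection g) (hc : (e + f) * g = g) :
    ∃ z a b : R, IsStarProjection z ∧ (∀ a, a * z = z * a) ∧ star a * a = z * g ∧ f * a = a ∧
      star b * b = (1 - z) * (e + f - g) ∧ e * b = b := by
  have hee := he.isIdempotentElem.eq
  have hff := hf.isIdempotentElem.eq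
  have hgg := hg.isIdempotentElem.eq
  have hes := he.isSelfAdjoint.star_eq
  have hfs := hf.isSelfAdjoint.star_eq
  have hgs := hg.isSelfAdjoint.star_eq
  have hfe : f * e = 0 := by simpa [hes, hfs] using congrArg star hef
  have hgc : g * (e + f) = g := by simpa [hes, hfs, hgs] using congrArg star hc
  have hg' : IsStarProjection (e + f - g) :=
    ⟨by simp only [IsIdempotentElem, sub_mul, mul_sub, add_mul, mul_add] at *
        grind, by simp [IsSelfAdjoint, hes, hfs, hgs]⟩
  obtain ⟨v, hvp, hvg, hfv, hv1, hv2, hv3, hv4⟩ := hR.exists_polar_mul hf hg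
  obtain ⟨u, hup, hug, heu, hu1, hu2, hu3, hu4⟩ := hR.exists_polar_mul he hg'
  have hK : g - star v * v = e - u * star u := by
    refine hv1.eq_of_forall_mul_eq_iff hu3 fun a => ?_
    rw [hv2, hu4, sub_mul]
    refine ⟨fun ⟨h1, h2⟩ => ?_, fun ⟨h1, h2⟩ => ?_⟩
    · have h3 : (e + f) * a = a := by rw [← h1, ← mul_assoc, hc]
      exact ⟨by rwa [add_mul, h2, add_zero] at h3, by rw [h3, h1, sub_self]⟩
    · have h3 : f * a = 0 := by rw [← h1, ← mul_assoc, hfe, zero_mul]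
      rw [add_mul, h1, h3, add_zero, sub_eq_zero] at h2
      exact ⟨h2.symm, h3⟩
  have hH : f - v * star v = e + f - g - star u * u := by
    refine hv3.eq_of_forall_mul_eq_iff hu1 fun a => ?_
    rw [hv4, hu2]
    refine ⟨fun ⟨h1, h2⟩ => ?_, fun ⟨h1, h2⟩ => ?_⟩
    · have h3 : e * a = 0 := by rw [← h1, ← mul_assoc, hef, zero_mul]
      exact ⟨by rw [sub_mul, add_mul, h1, h2, h3, zero_add, sub_zero], h3⟩
    · have h3 : (e + f) * a = a := by
        rw [← h1, ← mul_assoc, mul_sub, hc]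
        congr 2
        simp [add_mul, mul_add, hee, hff, hef, hfe]
      have h4 : g * a = 0 := by rwa [sub_mul, h3, sub_eq_self] at h1
      exact ⟨by rwa [add_mul, h2, zero_add] at h3, h4⟩
  obtain ⟨t, z, hz, hzc, ht, htK, hHt, hzK, hzH⟩ := hR.exists_comparison hv1 hv3
  have hzz := hz.isIdempotentElem.eq
  have hzs := hz.isSelfAdjoint.star_eq
  have remainder : ∀ {p a : R}, p * p = p → star p = p → p * a = a → a * star a * a = a →
      p * (p - a * star a) = p - a * star a ∧ star a * (p - a * star a) = 0 := by
    intro p a h1 h2 h3 h4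
    have h5 : star a * p = star a := by simpa [h2] using congrArg star h3
    have h6 : star a * (a * star a) = star a := by simpa [mul_assoc] using congrArg star h4
    exact ⟨by rw [mul_sub, h1, ← mul_assoc, h3], by rw [mul_sub, h5, h6, sub_self]⟩
  obtain ⟨hfH, hvH⟩ := remainder hff hfs hfv hvp
  obtain ⟨heK, huK⟩ := remainder hee hes heu hup
  have hKt : (g - star v * v) * star t = star t := by
    simpa [hgs] using congrArg star htK
  rw [hK] at hKt
  have hvt : star v * t = 0 := by rw [← hHt, ← mul_assoc, hvH, zero_mul]
  have hut : star u * star t = 0 := by rw [← hKt, ← mul_assoc, huK, zero_mul]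
  have htv : star t * v = 0 := by simpa using congrArg star hvt
  have htu : t * u = 0 := by simpa using congrArg star hut
  have hft : f * t = t := by rw [← hHt, ← mul_assoc, hfH]
  have het : e * star t = star t := by rw [← hKt, ← mul_assoc, heK]
  have hyy := hz.one_sub.isIdempotentElem.eq
  have hyc : ∀ a, a * (1 - z) = (1 - z) * a := fun a => by
    rw [mul_sub, sub_mul, hzc, mul_one, one_mul]
  refine ⟨z, z * (v + t), (1 - z) * (u + star t), hz, hzc, ?_, ?_, ?_, ?_⟩
  · rw [star_mul, hzs, mul_assoc, ← mul_assoc z z, hzz, ← hzc, ← mul_assoc]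
    simp only [star_add, add_mul _ _ (v + t), mul_add, hvt, htv]
    rw [zero_add, add_zero, hzc, mul_add, hzK, mul_sub, add_sub_cancel]
  · rw [← mul_assoc, hzc, mul_assoc, mul_add, hfv, hft]
  · rw [star_mul, hz.one_sub.isSelfAdjoint.star_eq, mul_assoc, ← mul_assoc (1 - z) (1 - z), hyy,
      ← hyc, ← mul_assoc]
    simp only [star_add, add_mul _ _ (u + star t), mul_add, hut, htu, star_star]
    rw [zero_add, add_zero, hyc, mul_add, hzH, hH, mul_sub _ _ (star u * u), add_sub_cancel]
  · rw [← mul_assoc, hyc, mul_assoc, mul_add, heu, het]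

/-- The orthogonal ranges of the powers `s ^ k * w` of a shift add up to a projection. -/
theorem exists_shift_support (hR : IsComparable R) {s w : R} (hw : w * star w * w = w)
    (hsw : star s * w = 0) (hssw : star s * s * w = w) (hsss : star s * s * s = s) :
    ∃ g : R, IsStarProjection g ∧ g = w * star w + s * g * star s ∧ star s * s * g = g ∧
      ∀ a, (∀ k : ℕ, a * (s ^ k * w) = 0) → a * g = 0 := by
  obtain ⟨g, hg, h⟩ := hR.support (Set.range fun k : ℕ => s ^ k * w)
  simp only [Set.forall_mem_range] at h
  have hgs := hg.isSelfAdjoint.star_eq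
  have hgk : ∀ k : ℕ, g * (s ^ k * w) = s ^ k * w := fun k => by
    have := (h (1 - g)).1 hg.one_sub_mul_self k
    rw [sub_mul, one_mul, sub_eq_zero] at this
    exact this.symm
  have hpow : ∀ k : ℕ, star s * s * (s ^ k * w) = s ^ k * w := by
    rintro (_ | k)
    · rw [pow_zero, one_mul, hssw]
    · rw [pow_succ', mul_assoc s, ← mul_assoc _ s, hsss]
  have hws : star w * s = 0 := by simpa using congrArg star hsw
  have fix : ∀ a, (∀ k : ℕ, a * (s ^ k * w) = s ^ k * w) → a * g = g := fun a ha => by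
    have := (h (a - 1)).2 fun k => by rw [sub_mul, ha, one_mul, sub_self]
    rwa [sub_mul, one_mul, sub_eq_zero] at this
  have h1 : g * w = w := by simpa using hgk 0
  have h2 : g * s * g = s * g := by
    have := (h (g * s - s)).2 fun k => by
      have := hgk (k + 1)
      rw [pow_succ', mul_assoc] at this
      rw [sub_mul, mul_assoc, this, sub_self]
    rwa [sub_mul, sub_eq_zero] at this
  have h3 : (w * star w + s * g * star s) * g = g := by
    refine fix _ fun k => ?_
    rcases k with _ | k
    · rw [pow_zero, one_mul, add_mul, hw, mul_assoc (s * g), hsw, mul_zero, add_zero]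
    · have e := hpow k
      have e' := hgk k
      have h4 : w * star w * (s * (s ^ k * w)) = 0 := by
        rw [mul_assoc, ← mul_assoc (star w), hws, zero_mul, mul_zero]
      have e1 : s ^ (k + 1) * w = s * (s ^ k * w) := by rw [pow_succ', mul_assoc]
      rw [e1, add_mul, h4, zero_add, mul_assoc (s * g), ← mul_assoc (star s), e, mul_assoc, e']
  refine ⟨g, hg, ?_, fix _ hpow, fun a ha => (h a).2 ha⟩
  have h4 := congrArg star h3
  simp only [star_mul, star_add, star_star, hgs] at h4
  rw [mul_add, ← mul_assoc, h1, ← mul_assoc s, ← mul_assoc, ← mul_assoc, h2] at h4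
  exact h4.symm

/-- A shift on an initial projection restricts to the support of its orbit. -/
theorem isShift_support {A s w g : R} (hg : IsStarProjection g) (hw : w * star w * w = w)
    (hAw : A * w = w) (hAs : A * s = s) (hsw : star s * w = 0)
    (hgw : g = w * star w + s * g * star s) (hsg : star s * s * g = g) :
    IsShift (star w * w) A w (s * g) := by
  have hgs := hg.isSelfAdjoint.star_eq
  have hgg := hg.isIdempotentElem.eq
  have h1 : g * star s * (s * g) = g := by rw [mul_assoc, ← mul_assoc _ s, hsg, hgg]
  refine ⟨rfl, hw, hAw, by rw [← mul_assoc, hAs], ?_, ?_, ?_⟩ <;> rw [star_mul, hgs]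
  · rw [mul_assoc, hsw, mul_zero]
  · rw [h1, mul_assoc s, ← mul_assoc g, hgg, ← mul_assoc]
    exact hgw
  · rw [mul_assoc, h1, mul_assoc, hgg]

end IsComparable

theorem IsStarProjection.star_add_of_central {R : Type*} [Ring R] [StarRing R] {z : R}
    (hz : IsStarProjection z) (hzc : ∀ a, a * z = z * a) (a b : R) :
    star (z * a + (1 - z) * b) = z * star a + (1 - z) * star b := by
  rw [star_add, star_mul, star_mul, hz.isSelfAdjoint.star_eq, hz.one_sub.isSelfAdjoint.star_eq,
    hzc, mul_sub, sub_mul, hzc, mul_one, one_mul]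

theorem IsStarProjection.add_mul_add_of_central {R : Type*} [Ring R] [StarRing R] {z : R}
    (hz : IsStarProjection z) (hzc : ∀ a, a * z = z * a) (a a' b b' : R) :
    (z * a + (1 - z) * a') * (z * b + (1 - z) * b') = z * (a * b) + (1 - z) * (a' * b') := by
  have hyc : ∀ a, a * (1 - z) = (1 - z) * a := fun a => by
    rw [mul_sub, sub_mul, hzc, mul_one, one_mul]
  have e1 : z * a * (z * b) = z * (a * b) := by
    rw [mul_assoc, ← mul_assoc a, hzc, mul_assoc, ← mul_assoc z, hz.isIdempotentElem.eq]
  have e2 : (1 - z) * a' * ((1 - z) * b') = (1 - z) * (a' * b') := by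
    rw [mul_assoc, ← mul_assoc a', hyc, mul_assoc, ← mul_assoc (1 - z),
      hz.one_sub.isIdempotentElem.eq]
  have e3 : z * a * ((1 - z) * b') = 0 := by
    rw [mul_assoc, ← mul_assoc a, hyc, mul_assoc, ← mul_assoc z, hz.mul_one_sub_self, zero_mul]
  have e4 : (1 - z) * a' * (z * b) = 0 := by
    rw [mul_assoc, ← mul_assoc a', hzc, mul_assoc, ← mul_assoc (1 - z), hz.one_sub_mul_self,
      zero_mul]
  rw [add_mul, mul_add, mul_add, e1, e2, e3, e4, add_zero, zero_add]

namespace IsShift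

variable {R : Type*} [Ring R] [StarRing R] {r A w s : R}

theorem star_mul_shift_mul_base (h : IsShift r A w s) : star s * s * w = w := by
  rw [h.star_mul_shift, add_mul, h.base_isometry, mul_assoc, h.star_mul_base, mul_zero, add_zero]

theorem star_base_mul (h : IsShift r A w s) : star w * s = 0 := by
  simpa using congrArg star h.star_mul_base

theorem star_mul_shift_mul_shift (h : IsShift r A w s) : star s * s * s = s := by
  rw [h.star_mul_shift, add_mul, h.isometry, mul_assoc, h.star_base_mul, mul_zero, zero_add]

theorem star_mul_shift_mul_star (h : IsShift r A w s) : star s * s * star s = star s := by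
  simpa [mul_assoc] using congrArg star h.isometry

/-- Transport of a shift along a partial isometry `t`, cut down by a central projection `z`. -/
theorem transport (h : IsShift r A w s) {z t B : R} (hz : IsStarProjection z)
    (hzc : ∀ a, a * z = z * a) (ht : star t * t * (star s * s) = z * (star s * s))
    (hB : B * t = t) : IsShift (z * r) B (z * t * w) (z * t * s * star t) := by
  have hzz := hz.isIdempotentElem.eq
  have hzs := hz.isSelfAdjoint.star_eq
  have hz' := mul_mul_of_mul_eq hzz
  have hl : ∀ a b, a * (z * b) = z * (a * b) := fun a b => by
    rw [← mul_assoc, hzc, mul_assoc]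
  have key : ∀ a, star s * s * a = a → star t * (t * a) = z * a := fun a ha => by
    rw [← ha, ← mul_assoc, ← mul_assoc, ht, mul_assoc]
  have hw := key w h.star_mul_shift_mul_base
  have hs := key s h.star_mul_shift_mul_shift
  have hs' := key (star s) h.star_mul_shift_mul_star
  have hs1 : ∀ a, star t * (t * (s * a)) = z * (s * a) := fun a => by
    rw [← mul_assoc t, ← mul_assoc, hs, mul_assoc]
  have hs2 : ∀ a, star t * (t * (star s * a)) = z * (star s * a) := fun a => by
    rw [← mul_assoc t, ← mul_assoc, hs', mul_assoc]
  have hB' := mul_mul_of_mul_eq hB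
  have e1 := h.star_mul_self
  have e2 := h.base_isometry
  have e3 := h.star_mul_base
  have e3' := mul_mul_of_mul_eq e3
  have e4 := h.star_mul_shift
  have e4' := mul_mul_of_mul_eq e4
  have e5 := h.isometry
  have e5' : ∀ a, s * (star s * (s * a)) = s * a := fun a => by
    rw [← mul_assoc (star s), ← mul_assoc, ← mul_assoc, e5]
  have e6 : w * r = w := by rw [← e1, ← mul_assoc, e2]
  simp only [mul_assoc] at e2 e4' e5
  constructor <;>
    simp only [star_mul, star_star, mul_assoc, hzs, hl t, hl s, hl w, hl (star t), hl (star s),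
      hl (star w), hl B, hzc (star t), hz', hw, hs1, hs2, hB', e1, e3, e5', e6, mul_zero]
  rw [← mul_add, ← mul_add, ← mul_assoc (star s), e4, add_mul]
  simp only [mul_assoc]

/-- A central projection and its complement glue shifts. -/
theorem add {z w' s' : R} (hz : IsStarProjection z) (hzc : ∀ a, a * z = z * a)
    (h : IsShift (z * r) A w s) (h' : IsShift ((1 - z) * r) A w' s') :
    IsShift r A (z * w + (1 - z) * w') (z * s + (1 - z) * s') := by
  have hyc : ∀ a, a * (1 - z) = (1 - z) * a := fun a => by
    rw [mul_sub, sub_mul, hzc, mul_one, one_mul]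
  have star_glue := hz.star_add_of_central hzc
  have glue_mul := hz.add_mul_add_of_central hzc
  have mul_glue : ∀ a b b' : R, a * (z * b + (1 - z) * b') = z * (a * b) + (1 - z) * (a * b') :=
    fun a b b' => by
      rw [mul_add, ← mul_assoc, ← mul_assoc, hzc, hyc, mul_assoc, mul_assoc]
  constructor
  · rw [star_glue, glue_mul, h.star_mul_self, h'.star_mul_self, ← mul_assoc, ← mul_assoc,
      hz.isIdempotentElem.eq, hz.one_sub.isIdempotentElem.eq, ← add_mul, add_sub_cancel, one_mul]
  · rw [star_glue, glue_mul, glue_mul, h.base_isometry, h'.base_isometry]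
  · rw [mul_glue, h.mul_base, h'.mul_base]
  · rw [mul_glue, h.mul_shift, h'.mul_shift]
  · rw [star_glue, glue_mul, h.star_mul_base, h'.star_mul_base, mul_zero, mul_zero, add_zero]
  · rw [star_glue, star_glue, glue_mul, glue_mul, glue_mul, h.star_mul_shift, h'.star_mul_shift,
      mul_add, mul_add]
    abel
  · rw [star_glue, glue_mul, glue_mul, h.isometry, h'.isometry]

theorem mul_star_mul_shift (h : IsShift r A w s) : A * (star s * s) = star s * s := by
  rw [h.star_mul_shift, mul_add, ← mul_assoc, ← mul_assoc, h.mul_base, h.mul_shift]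

end IsShift

namespace IsComparable

variable {R : Type*} [Ring R] [StarRing R]

/-- A shift in `e + f` restricts to a shift in `f` over a central projection and to one in `e`
over its complement. -/
theorem exists_shift_split (hR : IsComparable R) {e f r w s : R} (he : IsStarProjection e)
    (hf : IsStarProjection f) (hef : e * f = 0) (h : IsShift r (e + f) w s) :
    ∃ z : R, IsStarProjection z ∧ (∀ a, a * z = z * a) ∧
      (∃ w' s', IsShift (z * r) f w' s') ∧ ∃ w' s', IsShift ((1 - z) * r) e w' s' := by
  have h1 := h.star_mul_base
  have h2 := h.star_base_mul
  have h3 := h.star_mul_shift_mul_base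
  have h4 := h.star_mul_shift_mul_shift
  have h5 := h.star_mul_shift_mul_star
  have hq : star (s * s) * (s * s) = star s * s := by
    rw [star_mul, mul_assoc, ← mul_assoc (star s) s s, h4]
  obtain ⟨g, hg, hgw, hsg, hsupp⟩ := hR.exists_shift_support (s := s * s) h.base_isometry
    (by rw [star_mul, mul_assoc, h1, mul_zero]) (by rw [hq, h3])
    (by rw [hq, ← mul_assoc, h4])
  have hgs := hg.isSelfAdjoint.star_eq
  have hgg := hg.isIdempotentElem.eq
  rw [hq] at hsg
  have hstep : ∀ x, g * (s * (s * (s * x))) = s * (s * (g * (s * x))) := fun x => by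
    have e1 : star w * (s * (s * (s * x))) = 0 := by rw [← mul_assoc, h2, zero_mul]
    have e2 : ∀ y, star s * (s * (s * y)) = s * y := fun y => by
      rw [← mul_assoc, ← mul_assoc, h4]
    conv_lhs => rw [hgw]
    simp only [add_mul, mul_assoc, e1, mul_zero, zero_add, star_mul]
    rw [e2, e2]
  have hgsg : g * s * g = 0 := by
    refine hsupp _ fun k => ?_
    induction k with
    | zero =>
      have e1 : star s * (s * w) = w := by rw [← mul_assoc, h3]
      have e2 : star w * (s * w) = 0 := by rw [← mul_assoc, h2, zero_mul]
      rw [pow_zero, one_mul]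
      conv_lhs => rw [hgw]
      simp only [add_mul, mul_assoc, star_mul, e1, e2, h1, mul_zero, add_zero]
    | succ k ih =>
      have e1 : (s * s) ^ (k + 1) * w = s * (s * ((s * s) ^ k * w)) := by
        rw [pow_succ', mul_assoc, mul_assoc]
      rw [mul_assoc] at ih
      rw [mul_assoc, e1, hstep, ih, mul_zero, mul_zero]
  have hc : (e + f) * g = g := by
    conv_lhs => rw [hgw]
    simp only [mul_add, ← mul_assoc, h.mul_base, h.mul_shift]
    exact hgw.symm
  have hg' := isShift_support (A := e + f) (s := s * s) hg h.base_isometry h.mul_base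
    (by rw [← mul_assoc, h.mul_shift]) (by rw [star_mul, mul_assoc, h1, mul_zero]) hgw
    (by rw [hq, hsg])
  rw [h.star_mul_self] at hg'
  have hB : star (s * s * g) * (s * s * g) = g := by
    rw [star_mul, hgs, mul_assoc, ← mul_assoc _ (s * s), hq, hsg, hgg]
  obtain ⟨z, a, b, hz, hzc, ha, hfa, hb, heb⟩ := hR.exists_dichotomy he hf hef hg hc
  have hyc : ∀ a, a * (1 - z) = (1 - z) * a := fun a => by
    rw [mul_sub, sub_mul, hzc, mul_one, one_mul]
  have hcs : (e + f) * (s * g) = s * g := by rw [← mul_assoc, h.mul_shift]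
  refine ⟨z, hz, hzc, ⟨_, _, hg'.transport hz hzc (t := a) (B := f) ?_ hfa⟩,
    ⟨_, _, hg'.transport hz.one_sub hyc (t := b * s * g) (B := e) ?_ ?_⟩⟩
  · rw [hB, ha, mul_assoc, hgg]
  · rw [hB]
    simp only [star_mul, hgs, mul_assoc, hgg]
    rw [← mul_assoc (star b), hb, mul_assoc (1 - z), sub_mul (e + f), hcs, ← mul_assoc g s, hgsg,
      sub_zero, ← mul_assoc (star s), hyc, mul_assoc (1 - z), ← mul_assoc (star s), hsg,
      ← mul_assoc g, hyc, mul_assoc, hgg]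
  · rw [← mul_assoc, ← mul_assoc, heb]

end IsComparable

/-- A system of matrix units, not assumed to add up to `1`. -/
structure IsMatrixUnits {R ι : Type*} [Ring R] [StarRing R] (e : ι → ι → R) : Prop where
  star_eq : ∀ i j, star (e i j) = e j i
  mul_same : ∀ i j k, e i j * e j k = e i k
  mul_ne : ∀ i {j k} l, j ≠ k → e i j * e k l = 0

namespace IsMatrixUnits

variable {R ι : Type*} [Ring R] [StarRing R] {e f : ι → ι → R}

theorem isStarProjection (he : IsMatrixUnits e) (i : ι) : IsStarProjection (e i i) :=
  ⟨he.mul_same i i i, he.star_eq i i⟩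

theorem isStarProjection_sum (he : IsMatrixUnits e) (T : Finset ι) :
    IsStarProjection (∑ i ∈ T, e i i) := by
  classical
  refine ⟨?_, by simp [IsSelfAdjoint, star_sum, he.star_eq]⟩
  rw [IsIdempotentElem, Finset.sum_mul_sum]
  refine Finset.sum_congr rfl fun i hi => ?_
  rw [Finset.sum_eq_single_of_mem i hi fun j _ hj => he.mul_ne i j hj.symm, he.mul_same]

/-- A shift in a sum of equivalent projections can be compressed to one of them. -/
theorem exists_isShift (hR : IsComparable R) (he : IsMatrixUnits e) (o : ι) (T : Finset ι) :
    ∀ {r w s : R}, IsShift r (∑ i ∈ T, e i i) w s → ∃ w' s', IsShift r (e o o) w' s' := by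
  classical
  induction T using Finset.induction_on with
  | empty =>
    intro r w s h
    have hw : w = 0 := by rw [← h.mul_base, Finset.sum_empty, zero_mul]
    have hr : r = 0 := by rw [← h.star_mul_self, hw, mul_zero]
    exact ⟨0, 0, by constructor <;> simp [hr]⟩
  | insert j T hj ih =>
    intro r w s h
    rw [Finset.sum_insert hj, add_comm] at h
    obtain ⟨z, hz, hzc, ⟨w₁, s₁, h₁⟩, w₂, s₂, h₂⟩ := hR.exists_shift_split
      (he.isStarProjection_sum T) (he.isStarProjection j)
      (by
        rw [Finset.sum_mul]
        exact Finset.sum_eq_zero fun i hi => he.mul_ne i j fun h => hj (h ▸ hi)) h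
    obtain ⟨w₂, s₂, h₂⟩ := ih h₂
    have h₁ := h₁.transport (z := 1) (t := e o j) (B := e o o) (.one R) (by simp)
      (by rw [he.star_eq, he.mul_same, h₁.mul_star_mul_shift, one_mul]) (he.mul_same o o j)
    rw [one_mul] at h₁
    exact ⟨_, _, h₁.add hz hzc h₂⟩

end IsMatrixUnits

namespace IsShift

variable {R : Type*} [Ring R] [StarRing R] {r A w s : R}

/-- A projection absorbs an orthogonal projection that shifts through it. -/
theorem exists_absorb (h : IsShift r A w s) (hA : IsStarProjection A) (hr : IsStarProjection r)
    (hAr : A * r = 0) : ∃ m : R, star m * m = A + r ∧ m * star m = A := by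
  have hAA := hA.isIdempotentElem.eq
  have hAs := hA.isSelfAdjoint.star_eq
  have hrA : r * A = 0 := by
    simpa [hA.isSelfAdjoint.star_eq, hr.isSelfAdjoint.star_eq] using congrArg star hAr
  have b1 := h.mul_star_mul_shift
  have b2 : star s * s * A = star s * s := by simpa [hAs] using congrArg star b1
  have b3 := h.star_mul_shift_mul_base
  have b4 := h.star_mul_shift_mul_shift
  have b5 := h.star_mul_shift_mul_star
  have b6 : star s * s * (star s * s) = star s * s := by rw [← mul_assoc, b5]
  have b7 : star s * (star s * s) = star s := by simpa using congrArg star b4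
  have b8 : star w * (star s * s) = star w := by simpa using congrArg star b3
  have w1 : star w * A = star w := by simpa [hAs] using congrArg star h.mul_base
  have s1 : star s * A = star s := by simpa [hAs] using congrArg star h.mul_shift
  have s2 : s * (star s * s) = s := by rw [← mul_assoc, h.isometry]
  have s3 : s * A = s := by rw [← s2, mul_assoc, b2]
  have s4 : A * star s = star s := by simpa [hAs] using congrArg star s3
  have w2 : w * r = w := by rw [← h.star_mul_self, ← mul_assoc, h.base_isometry]
  have w3 : w * A = 0 := by rw [← w2, mul_assoc, hrA, mul_zero]
  have w4 : A * star w = 0 := by simpa [hAs] using congrArg star w3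
  have w5 : s * star w = 0 := by rw [← s3, mul_assoc, w4, mul_zero]
  have w6 : w * star s = 0 := by simpa using congrArg star w5
  have w7 : w * (star s * s) = 0 := by rw [← mul_assoc, w6, zero_mul]
  have w8 : star s * s * star w = 0 := by rw [mul_assoc, w5, mul_zero]
  have e1 := h.star_mul_self
  have e2 := h.star_mul_base
  have e3 := h.star_base_mul
  have e4 := h.star_mul_shift
  have e5 := h.mul_base
  have e6 := h.mul_shift
  have hm : star (A - star s * s + s + w) = A - star s * s + star s + star w := by
    simp [hAs]
  refine ⟨A - star s * s + s + w, ?_, ?_⟩ <;> rw [hm] <;>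
    simp only [add_mul, mul_add, sub_mul, mul_sub, hAA, b1, b2, b3, b4, b5, b6, b7, b8, w1, w3, w4,
      w5, w6, w7, w8, s1, s2, s3, s4, e1, e2, e3, e5, e6]
  · abel
  · rw [e4]; abel

end IsShift

namespace IsMatrixUnits

variable {R ι : Type*} [Ring R] [StarRing R] {e f : ι → ι → R}

/-- Cantor-Bernstein for one summand: a subequivalence between corresponding diagonal units of two
systems of matrix units with the same sum improves to an equivalence. -/
theorem exists_equiv_of_subequiv [Fintype ι] (hR : IsComparable R) (he : IsMatrixUnits e)
    (hf : IsMatrixUnits f) (hef : ∑ i, e i i = ∑ i, f i i) (o : ι) {v : R}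
    (hv : star v * v = e o o) (hfv : f o o * v = v) :
    ∃ y, star y * y = e o o ∧ y * star y = f o o := by
  classical
  have hve := hR.mul_of_star_mul_self (he.isStarProjection o) hv
  have hev : e o o * star v = star v := by simpa [he.star_eq] using congrArg star hve
  have hvf : star v * f o o = star v := by simpa [hf.star_eq] using congrArg star hfv
  have hvv : v * star v * v = v := by rw [mul_assoc, hv, hve]
  have hvvv : star v * (v * star v) = star v := by simpa using congrArg star hvv
  have hA : IsStarProjection (v * star v) :=
    ⟨by rw [IsIdempotentElem, ← mul_assoc, hvv], by simp [IsSelfAdjoint]⟩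
  set r := f o o - v * star v with hr_def
  have hfr : f o o * r = r := by rw [mul_sub, hf.mul_same, ← mul_assoc, hfv]
  have hvr : star v * r = 0 := by rw [mul_sub, hvf, hvvv, sub_self]
  have hAr : v * star v * r = 0 := by rw [mul_assoc, hvr, mul_zero]
  have hr : IsStarProjection r := by
    refine ⟨?_, by simp [IsSelfAdjoint, hr_def, hf.star_eq]⟩
    nth_rewrite 1 [IsIdempotentElem, hr_def]
    rw [sub_mul, hfr, hAr, sub_zero]
  have hfi : ∀ i, (∑ j, f j j) * f i o = f i o := fun i => by
    rw [Finset.sum_mul, Finset.sum_eq_single_of_mem i (Finset.mem_univ i) fun j _ hj =>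
      hf.mul_ne j o hj, hf.mul_same]
  set c := ∑ i, f i i
  have hcr : c * r = r := by rw [← hfr, ← mul_assoc, hfi]
  set s := ∑ i, f i o * v * e o i with hs_def
  have hss : star s = ∑ i, e i o * star v * f o i := by
    simp [hs_def, star_sum, he.star_eq, hf.star_eq, mul_assoc]
  have hcs : c * s = s := by
    rw [hs_def, Finset.mul_sum]
    simp only [← mul_assoc, hfi]
  have hsc : star s * s = c := by
    rw [hss, hs_def, Finset.sum_mul_sum, ← hef]
    refine Finset.sum_congr rfl fun i hi => ?_
    rw [Finset.sum_eq_single_of_mem i hi fun j _ hj => ?_]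
    · rw [mul_assoc _ (f o i), ← mul_assoc (f o i), ← mul_assoc (f o i), hf.mul_same, hfv,
        ← mul_assoc, mul_assoc _ (star v), hv, he.mul_same, he.mul_same]
    · rw [mul_assoc _ (f o i), ← mul_assoc (f o i), ← mul_assoc (f o i), hf.mul_ne o o hj.symm,
        zero_mul, zero_mul, mul_zero]
  have hsr : star s * r = 0 := by
    rw [hss, Finset.sum_mul]
    refine Finset.sum_eq_zero fun i _ => ?_
    rw [← hfr, mul_assoc, ← mul_assoc (f o i)]
    by_cases hi : i = o
    · rw [hi, hf.mul_same, hfr, mul_assoc, hvr, mul_zero]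
    · rw [hf.mul_ne o o hi, zero_mul, mul_zero]
  have hrr : r * star r * r = r := by
    rw [hr.isSelfAdjoint.star_eq, hr.isIdempotentElem.eq, hr.isIdempotentElem.eq]
  obtain ⟨g, hg, hgr, hsg, -⟩ := hR.exists_shift_support (s := s) hrr hsr (by rw [hsc, hcr])
    (by rw [hsc, hcs])
  have h := IsComparable.isShift_support hg hrr hcr hcs hsr hgr hsg
  rw [hr.isSelfAdjoint.star_eq, hr.isIdempotentElem.eq, ← hef] at h
  obtain ⟨w', s', h⟩ := exists_isShift hR he o _ h
  have h := h.transport (z := 1) (t := v) (B := v * star v) (.one R) (by simp)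
    (by rw [hv, h.mul_star_mul_shift, one_mul]) hvv
  rw [one_mul] at h
  obtain ⟨m, hm, hm'⟩ := h.exists_absorb hA hr hAr
  rw [hr_def, add_sub_cancel] at hm
  refine ⟨star m * v, ?_, ?_⟩
  · rw [star_mul, star_star, mul_assoc, ← mul_assoc m, hm', hvv, hv]
  · rw [star_mul, star_star, mul_assoc, ← mul_assoc v, ← hm', mul_assoc, hm, ← mul_assoc, hm,
      hf.mul_same]

theorem central_mul (he : IsMatrixUnits e) {z : R} (hz : IsStarProjection z)
    (hzc : ∀ a, a * z = z * a) : IsMatrixUnits fun i j => z * e i j := by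
  have h : ∀ a b, z * a * (z * b) = z * (a * b) := fun a b => by
    rw [mul_assoc, ← mul_assoc a, hzc, mul_assoc, ← mul_assoc z, hz.isIdempotentElem.eq]
  constructor
  · intro i j
    rw [star_mul, hz.isSelfAdjoint.star_eq, he.star_eq, hzc]
  · intro i j k
    rw [h, he.mul_same]
  · intro i j k l hjk
    rw [h, he.mul_ne i l hjk, mul_zero]

/-- Corresponding diagonal units of two finite systems of matrix units are equivalent. -/
theorem exists_equiv [Fintype ι] (hR : IsComparable R) (he : IsMatrixUnits e)
    (hf : IsMatrixUnits f) (he1 : ∑ i, e i i = 1) (hf1 : ∑ i, f i i = 1) (o : ι) :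
    ∃ y, star y * y = e o o ∧ y * star y = f o o := by
  obtain ⟨v, z, hz, hzc, -, hvp, hqv, h1, h2⟩ :=
    hR.exists_comparison (he.isStarProjection o) (hf.isStarProjection o)
  have hyc : ∀ a, a * (1 - z) = (1 - z) * a := fun a => by
    rw [mul_sub, sub_mul, hzc, mul_one, one_mul]
  have hpv : e o o * star v = star v := by simpa [he.star_eq] using congrArg star hvp
  have cut : ∀ {c a b : R}, IsStarProjection c → (∀ a, a * c = c * a) →
      c * a * (c * b) = c * (a * b) := fun {c a b} hc hcc => by
    rw [mul_assoc, ← mul_assoc a, hcc, mul_assoc, ← mul_assoc c, hc.isIdempotentElem.eq]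
  have star_cut : ∀ {c a : R}, IsStarProjection c → (∀ a, a * c = c * a) →
      star (c * a) = c * star a := fun {c a} hc hcc => by
    rw [star_mul, hc.isSelfAdjoint.star_eq, hcc]
  obtain ⟨a, ha, ha'⟩ := exists_equiv_of_subequiv hR (he.central_mul hz hzc)
    (hf.central_mul hz hzc) (by rw [← Finset.mul_sum, ← Finset.mul_sum, he1, hf1]) o (v := z * v)
    (by rw [star_cut hz hzc, cut hz hzc, h1]) (by rw [cut hz hzc, hqv])
  obtain ⟨b, hb, hb'⟩ := exists_equiv_of_subequiv hR (hf.central_mul hz.one_sub hyc)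
    (he.central_mul hz.one_sub hyc) (by rw [← Finset.mul_sum, ← Finset.mul_sum, he1, hf1]) o
    (v := (1 - z) * star v)
    (by rw [star_cut hz.one_sub hyc, cut hz.one_sub hyc, star_star, h2])
    (by rw [cut hz.one_sub hyc, hpv])
  refine ⟨z * a + (1 - z) * star b, ?_, ?_⟩ <;>
    rw [hz.star_add_of_central hzc, hz.add_mul_add_of_central hzc, star_star]
  · rw [ha, hb', ← mul_assoc, ← mul_assoc, hz.isIdempotentElem.eq, hz.one_sub.isIdempotentElem.eq,
      ← add_mul, add_sub_cancel, one_mul]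
  · rw [ha', hb, ← mul_assoc, ← mul_assoc, hz.isIdempotentElem.eq, hz.one_sub.isIdempotentElem.eq,
      ← add_mul, add_sub_cancel, one_mul]

end IsMatrixUnits

section Operators

open scoped InnerProductSpace

/-- The operator acting diagonally on pairs. -/
noncomputable def diagOperator {E : Type*} [NormedAddCommGroup E] [InnerProductSpace ℂ E]
    (s : E →L[ℂ] E) : WithLp 2 (E × E) →L[ℂ] WithLp 2 (E × E) :=
  (WithLp.prodContinuousLinearEquiv 2 ℂ E E).symm.toContinuousLinearMap ∘L (s.prodMap s) ∘L
    (WithLp.prodContinuousLinearEquiv 2 ℂ E E).toContinuousLinearMap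

@[simp]
theorem diagOperator_apply {E : Type*} [NormedAddCommGroup E] [InnerProductSpace ℂ E]
    (s : E →L[ℂ] E) (x : WithLp 2 (E × E)) :
    diagOperator s x = WithLp.toLp 2 (s x.fst, s x.snd) :=
  rfl

variable {E : Type*} [NormedAddCommGroup E] [InnerProductSpace ℂ E] [CompleteSpace E]

/-- The projection onto the closure of an invariant subspace commutes with the operator, when the
subspace is also invariant under the adjoint operator. -/
theorem Submodule.starProjection_topologicalClosure_apply_comm {U : Submodule ℂ E} {a b : E →L[ℂ] E}
    (hab : ∀ x y, ⟪a x, y⟫_ℂ = ⟪x, b y⟫_ℂ) (ha : ∀ x ∈ U, a x ∈ U) (hb : ∀ x ∈ U, b x ∈ U) (x : E) :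
    U.topologicalClosure.starProjection (a x) = a (U.topologicalClosure.starProjection x) := by
  refine Submodule.eq_starProjection_of_mem_orthogonal ?_ ?_
  · have := Submodule.starProjection_apply_mem U.topologicalClosure x
    rw [← SetLike.mem_coe, Submodule.topologicalClosure_coe] at this ⊢
    exact map_mem_closure a.continuous this ha
  · rw [← map_sub, Submodule.orthogonal_closure, Submodule.mem_orthogonal']
    intro y hy
    rw [hab]
    exact Submodule.inner_left_of_mem_orthogonal (K := U.topologicalClosure)
      (U.le_topologicalClosure (hb y hy)) (Submodule.sub_starProjection_mem_orthogonal x)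

theorem ContinuousLinearMap.eq_zero_of_forall_mem_of_orthogonal {U : Submodule ℂ E} {a : E →L[ℂ] E}
    (h : ∀ x ∈ U, a x = 0) (h' : ∀ x ∈ Uᗮ, a x = 0) : a = 0 := by
  have hcl : ∀ x ∈ U.topologicalClosure, a x = 0 := fun x hx =>
    closure_minimal (t := {x | a x = 0}) h (isClosed_eq a.continuous continuous_const) hx
  ext x
  have := U.topologicalClosure.sub_starProjection_mem_orthogonal x
  rw [Submodule.orthogonal_closure] at this
  have := h' _ this
  rw [map_sub, hcl _ (Submodule.starProjection_apply_mem _ x), sub_zero] at this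
  exact this

/-- Graphs of partial isometries commuting with every operator in `S` and its adjoint, possibly
with non-closed domain. -/
structure IsIsometricGraph (S : Set (E →L[ℂ] E)) (G : Submodule ℂ (WithLp 2 (E × E))) : Prop where
  norm_eq : ∀ x ∈ G, ‖x.fst‖ = ‖x.snd‖
  mem : ∀ s ∈ S, ∀ x ∈ G, WithLp.toLp 2 (s x.fst, s x.snd) ∈ G
  adjoint_mem : ∀ s ∈ S, ∀ x ∈ G, WithLp.toLp 2 (star s x.fst, star s x.snd) ∈ G

theorem IsIsometricGraph.inner_eq {S : Set (E →L[ℂ] E)} {G : Submodule ℂ (WithLp 2 (E × E))}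
    (h : IsIsometricGraph S G) {x y : WithLp 2 (E × E)} (hx : x ∈ G) (hy : y ∈ G) :
    ⟪x.fst, y.fst⟫_ℂ = ⟪x.snd, y.snd⟫_ℂ := by
  have h1 := h.norm_eq _ (G.add_mem hx hy)
  have h2 := h.norm_eq _ (G.sub_mem hx hy)
  have h3 := h.norm_eq _ (G.add_mem hx (G.smul_mem Complex.I hy))
  have h4 := h.norm_eq _ (G.sub_mem hx (G.smul_mem Complex.I hy))
  simp only [WithLp.add_fst, WithLp.add_snd, WithLp.sub_fst, WithLp.sub_snd, WithLp.smul_fst,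
    WithLp.smul_snd] at h1 h2 h3 h4
  rw [inner_eq_sum_norm_sq_div_four, inner_eq_sum_norm_sq_div_four]
  simp only [RCLike.I_to_complex]
  rw [h1, h2, h3, h4]

/-- An isometric graph extends to a partial isometry in the commutant. -/
theorem IsIsometricGraph.exists_extension {S : Set (E →L[ℂ] E)}
    {G : Submodule ℂ (WithLp 2 (E × E))} (h : IsIsometricGraph S G) :
    ∃ v ∈ StarSubalgebra.centralizer ℂ S, v * star v * v = v ∧
      (∀ x ∈ G, v x.fst = x.snd) ∧ (∀ x ∈ G, star v x.snd = x.fst) ∧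
      (∀ y, (∀ x ∈ G, ⟪x.fst, y⟫_ℂ = 0) → v y = 0) ∧
      ∀ y, (∀ x ∈ G, ⟪x.snd, y⟫_ℂ = 0) → star v y = 0 := by
  set P := G.topologicalClosure.starProjection with hP
  set inl : E →L[ℂ] WithLp 2 (E × E) :=
    (WithLp.prodContinuousLinearEquiv 2 ℂ E E).symm.toContinuousLinearMap ∘L
      ContinuousLinearMap.inl ℂ E E
  set inr : E →L[ℂ] WithLp 2 (E × E) :=
    (WithLp.prodContinuousLinearEquiv 2 ℂ E E).symm.toContinuousLinearMap ∘L
      ContinuousLinearMap.inr ℂ E E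
  have hinl : ∀ x, inl x = WithLp.toLp 2 (x, 0) := fun x => rfl
  have hinr : ∀ x, inr x = WithLp.toLp 2 (0, x) := fun x => rfl
  set v : E →L[ℂ] E := (2 : ℂ) • (WithLp.sndL 2 ℂ E E ∘L P ∘L inl)
  set u : E →L[ℂ] E := (2 : ℂ) • (WithLp.fstL 2 ℂ E E ∘L P ∘L inr)
  have hv : ∀ x, v x = (2 : ℂ) • (P (inl x)).snd := fun x => rfl
  have hu : ∀ x, u x = (2 : ℂ) • (P (inr x)).fst := fun x => rfl
  have hsymm : ∀ x y, ⟪P x, y⟫_ℂ = ⟪x, P y⟫_ℂ := fun x y =>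
    Submodule.inner_starProjection_left_eq_right _ x y
  have huv : u = star v := by
    rw [ContinuousLinearMap.star_eq_adjoint, ContinuousLinearMap.eq_adjoint_iff]
    intro x y
    have := hsymm (inr x) (inl y)
    simp only [WithLp.prod_inner_apply, hinl, hinr] at this
    simp only [hv, hu, inner_smul_left, inner_smul_right, Complex.conj_ofNat]
    simpa [hinl, hinr] using this
  have hPG : ∀ x ∈ G, P (inl x.fst) = (2 : ℂ)⁻¹ • x ∧ P (inr x.snd) = (2 : ℂ)⁻¹ • x := by
    intro x hx
    have mem := G.topologicalClosure.smul_mem (2 : ℂ)⁻¹ (G.le_topologicalClosure hx)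
    constructor <;>
    · refine Submodule.eq_starProjection_of_mem_orthogonal mem ?_
      rw [Submodule.orthogonal_closure, Submodule.mem_orthogonal]
      intro y hy
      have := h.inner_eq hy hx
      simp only [WithLp.prod_inner_apply, hinl, hinr]
      simp [inner_sub_right, inner_smul_right, this]
      ring
  have hGv : ∀ x ∈ G, v x.fst = x.snd := fun x hx => by
    rw [hv, (hPG x hx).1, WithLp.smul_snd, smul_smul]
    norm_num
  have hGu : ∀ x ∈ G, u x.snd = x.fst := fun x hx => by
    rw [hu, (hPG x hx).2, WithLp.smul_fst, smul_smul]
    norm_num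
  have hv0 : ∀ y, (∀ x ∈ G, ⟪x.fst, y⟫_ℂ = 0) → v y = 0 := fun y hy => by
    have : P (inl y) = 0 := by
      rw [hP, Submodule.starProjection_apply_eq_zero_iff, Submodule.orthogonal_closure,
        Submodule.mem_orthogonal]
      intro x hx
      simp [WithLp.prod_inner_apply, hinl, hy x hx]
    rw [hv, this]
    simp
  have hu0 : ∀ y, (∀ x ∈ G, ⟪x.snd, y⟫_ℂ = 0) → u y = 0 := fun y hy => by
    have : P (inr y) = 0 := by
      rw [hP, Submodule.starProjection_apply_eq_zero_iff, Submodule.orthogonal_closure,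
        Submodule.mem_orthogonal]
      intro x hx
      simp [WithLp.prod_inner_apply, hinr, hy x hx]
    rw [hu, this]
    simp
  have comm : ∀ s t : E →L[ℂ] E, (∀ x y, ⟪s x, y⟫_ℂ = ⟪x, t y⟫_ℂ) →
      (∀ x ∈ G, diagOperator s x ∈ G) → (∀ x ∈ G, diagOperator t x ∈ G) → s * v = v * s := by
    intro s t hst hs ht
    ext x
    have := Submodule.starProjection_topologicalClosure_apply_comm (U := G) (a := diagOperator s)
      (b := diagOperator t) (fun x y => by simp [WithLp.prod_inner_apply, hst]) hs ht (inl x)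
    have e : diagOperator s (inl x) = inl (s x) := by simp [hinl]
    rw [e] at this
    simp [hv, hP, this]
  refine ⟨v, StarSubalgebra.mem_centralizer_iff ℂ |>.2 fun s hs => ⟨?_, ?_⟩, ?_, hGv, huv ▸ hGu, hv0,
    huv ▸ hu0⟩
  · exact comm s (star s) (fun x y => (ContinuousLinearMap.adjoint_inner_right s x y).symm)
      (h.mem s hs) (h.adjoint_mem s hs)
  · exact comm (star s) s (fun x y => ContinuousLinearMap.adjoint_inner_left s y x)
      (h.adjoint_mem s hs) (h.mem s hs)
  · rw [← huv, ← sub_eq_zero]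
    refine ContinuousLinearMap.eq_zero_of_forall_mem_of_orthogonal
      (U := G.map (WithLp.fstL 2 ℂ E E).toLinearMap) ?_ fun y hy => ?_
    · rintro _ ⟨x, hx, rfl⟩
      change v (u (v x.fst)) - v x.fst = 0
      rw [hGv x hx, hGu x hx, hGv x hx, sub_self]
    · have : v y = 0 := hv0 y fun x hx => hy _ ⟨x, hx, rfl⟩
      simp [this]

/-- The absolute value of an operator `t` in a commutant, and the isometric graph on which it is
sent to `t`. -/
theorem exists_abs_isIsometricGraph {S : Set (E →L[ℂ] E)} {t : E →L[ℂ] E}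
    (ht : t ∈ StarSubalgebra.centralizer ℂ S) :
    ∃ h : E →L[ℂ] E, star h = h ∧ (∀ x, ‖h x‖ = ‖t x‖) ∧ ∃ G : Submodule ℂ (WithLp 2 (E × E)),
      IsIsometricGraph S G ∧ ∀ x, x ∈ G ↔ ∃ y, h y = x.fst ∧ t y = x.snd := by
  rw [StarSubalgebra.mem_centralizer_iff] at ht
  have hsa : star (CFC.abs t) = CFC.abs t := (CFC.abs_nonneg t).isSelfAdjoint.star_eq
  have hn : ∀ x, ‖CFC.abs t x‖ = ‖t x‖ := fun x => by
    have e : ∀ a : E →L[ℂ] E, ⟪a x, a x⟫_ℂ = ⟪x, (star a * a) x⟫_ℂ := fun a =>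
      (ContinuousLinearMap.adjoint_inner_right a x (a x)).symm
    have := e (CFC.abs t)
    rw [hsa, CFC.abs_mul_abs, ← e, inner_self_eq_norm_sq_to_K, inner_self_eq_norm_sq_to_K] at this
    exact (pow_left_inj₀ (norm_nonneg _) (norm_nonneg _) two_ne_zero).1 (by exact_mod_cast this)
  have comm : ∀ c : E →L[ℂ] E, c * t = t * c → star c * t = t * star c →
      c * CFC.abs t = CFC.abs t * c := fun c h1 h2 =>
    Commute.cfcAbs_right (a := t) h1.symm h2.symm
  refine ⟨CFC.abs t, hsa, hn, LinearMap.range ((WithLp.prodContinuousLinearEquiv 2 ℂ E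
    E).symm.toContinuousLinearMap ∘L ((CFC.abs t).prod t)).toLinearMap, ⟨?_, ?_, ?_⟩, ?_⟩
  · rintro _ ⟨y, rfl⟩
    exact hn y
  · rintro s hs _ ⟨y, rfl⟩
    refine ⟨s y, ?_⟩
    have h1 := DFunLike.congr_fun (comm s (ht s hs).1 (ht s hs).2) y
    have h2 := DFunLike.congr_fun (ht s hs).1 y
    exact congrArg (WithLp.toLp 2) (Prod.ext h1.symm h2.symm)
  · rintro s hs _ ⟨y, rfl⟩
    refine ⟨star s y, ?_⟩
    have h1 := DFunLike.congr_fun (comm (star s) (ht s hs).2 (by simpa using (ht s hs).1)) y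
    have h2 := DFunLike.congr_fun (ht s hs).2 y
    exact congrArg (WithLp.toLp 2) (Prod.ext h1.symm h2.symm)
  · intro x
    refine exists_congr fun y => ⟨?_, fun ⟨h1, h2⟩ => ?_⟩
    · rintro rfl
      exact ⟨rfl, rfl⟩
    · exact congrArg (WithLp.toLp 2) (Prod.ext h1 h2)

theorem centralizer_proper {S : Set (E →L[ℂ] E)} (a : StarSubalgebra.centralizer ℂ S)
    (h : star a * a = 0) : a = 0 :=
  Subtype.ext (CStarRing.star_mul_self_eq_zero_iff a.1 |>.1 (congrArg Subtype.val h))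

theorem centralizer_support {S : Set (E →L[ℂ] E)} (X : Set (StarSubalgebra.centralizer ℂ S)) :
    ∃ b : StarSubalgebra.centralizer ℂ S, IsStarProjection b ∧
      ∀ a, a * b = 0 ↔ ∀ x ∈ X, a * x = 0 := by
  set U : Submodule ℂ E := ⨆ x ∈ X, LinearMap.range (x.1 : E →L[ℂ] E).toLinearMap
  set P := U.topologicalClosure.starProjection
  have hinv : ∀ s : E →L[ℂ] E, (∀ x ∈ X, s * x.1 = x.1 * s) → ∀ y ∈ U, s y ∈ U := by
    intro s hs
    change U ≤ U.comap s.toLinearMap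
    refine iSup₂_le fun x hx => ?_
    rintro _ ⟨y, rfl⟩
    exact Submodule.mem_iSup_of_mem x (Submodule.mem_iSup_of_mem hx
      ⟨s y, (DFunLike.congr_fun (hs x hx) y).symm⟩)
  have hc : ∀ s ∈ S, ∀ x : StarSubalgebra.centralizer ℂ S, s * x.1 = x.1 * s ∧
      star s * x.1 = x.1 * star s := fun s hs x => (StarSubalgebra.mem_centralizer_iff ℂ).1 x.2 s hs
  have hP : P ∈ StarSubalgebra.centralizer ℂ S := by
    refine (StarSubalgebra.mem_centralizer_iff ℂ).2 fun s hs => ⟨?_, ?_⟩ <;> ext x <;> symm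
    · exact Submodule.starProjection_topologicalClosure_apply_comm (b := star s)
        (fun x y => (ContinuousLinearMap.adjoint_inner_right s x y).symm)
        (hinv s fun x _ => (hc s hs x).1) (hinv (star s) fun x _ => (hc s hs x).2) x
    · exact Submodule.starProjection_topologicalClosure_apply_comm (b := s)
        (fun x y => ContinuousLinearMap.adjoint_inner_left s y x)
        (hinv (star s) fun x _ => (hc s hs x).2) (hinv s fun x _ => (hc s hs x).1) x
  have hPp : IsStarProjection P := isStarProjection_starProjection
  refine ⟨⟨P, hP⟩, ⟨Subtype.ext hPp.isIdempotentElem, Subtype.ext hPp.isSelfAdjoint⟩,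
    fun a => ⟨fun h x hx => Subtype.ext ?_, fun h => Subtype.ext ?_⟩⟩
  · ext y
    have hy : P (x.1 y) = x.1 y := Submodule.starProjection_eq_self_iff.2
      (U.le_topologicalClosure (Submodule.mem_iSup_of_mem x (Submodule.mem_iSup_of_mem hx
        ⟨y, rfl⟩)))
    have := DFunLike.congr_fun (congrArg Subtype.val h) (x.1 y)
    change a.1 (P (x.1 y)) = 0 at this
    rwa [hy] at this
  · ext y
    have hU : U ≤ LinearMap.ker a.1.toLinearMap := by
      refine iSup₂_le fun x hx => ?_
      rintro _ ⟨y, rfl⟩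
      exact DFunLike.congr_fun (congrArg Subtype.val (h x hx)) y
    exact Submodule.topologicalClosure_minimal U hU (ContinuousLinearMap.isClosed_ker a.1)
      (Submodule.starProjection_apply_mem _ y)

theorem centralizer_polar {S : Set (E →L[ℂ] E)} (t : StarSubalgebra.centralizer ℂ S) :
    ∃ v : StarSubalgebra.centralizer ℂ S, v * star v * v = v ∧ (∀ a, t * a = 0 ↔ v * a = 0) ∧
      ∀ a, star t * a = 0 ↔ star v * a = 0 := by
  obtain ⟨h, hs, hn, G, hG, hmem⟩ := exists_abs_isIsometricGraph t.2
  obtain ⟨v, hv, hvv, h1, h2, h3, h4⟩ := hG.exists_extension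
  have h1 : v * h = t.1 := ContinuousLinearMap.ext fun y =>
    h1 (WithLp.toLp 2 (h y, t.1 y)) ((hmem _).2 ⟨y, rfl, rfl⟩)
  have h2 : star v * t.1 = h := ContinuousLinearMap.ext fun y =>
    h2 (WithLp.toLp 2 (h y, t.1 y)) ((hmem _).2 ⟨y, rfl, rfl⟩)
  have h1' : h * star v = star t.1 := by simpa [hs] using congrArg star h1
  have h2' : star t.1 * v = h := by simpa [hs] using congrArg star h2
  refine ⟨⟨v, hv⟩, Subtype.ext hvv, fun a => ?_, fun a => ?_⟩ <;>
    simp only [Subtype.ext_iff] <;> refine ⟨fun h0 => ?_, fun h0 => ?_⟩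
  · change t.1 * a.1 = 0 at h0
    change v * a.1 = 0
    ext y
    refine h3 _ fun x hx => ?_
    obtain ⟨z, hz, -⟩ := (hmem x).1 hx
    have : h * a.1 = 0 := by rw [← h2, mul_assoc, h0, mul_zero]
    rw [← hz, ← ContinuousLinearMap.adjoint_inner_right, ← ContinuousLinearMap.star_eq_adjoint, hs]
    have := DFunLike.congr_fun this y
    change h (a.1 y) = 0 at this
    exact (congrArg _ this).trans (inner_zero_right _)
  · change v * a.1 = 0 at h0
    change t.1 * a.1 = 0
    have h5 : h * a.1 = 0 := by rw [← h2', mul_assoc, h0, mul_zero]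
    rw [← h1, mul_assoc, h5, mul_zero]
  · change star t.1 * a.1 = 0 at h0
    change star v * a.1 = 0
    ext y
    refine h4 _ fun x hx => ?_
    obtain ⟨z, -, hz⟩ := (hmem x).1 hx
    rw [← hz, ← ContinuousLinearMap.adjoint_inner_right, ← ContinuousLinearMap.star_eq_adjoint]
    have := DFunLike.congr_fun h0 y
    change star t.1 (a.1 y) = 0 at this
    exact (congrArg _ this).trans (inner_zero_right _)
  · change star v * a.1 = 0 at h0
    change star t.1 * a.1 = 0
    rw [← h1', mul_assoc, h0, mul_zero]

theorem centralizer_maximal {S : Set (E →L[ℂ] E)} (p q : StarSubalgebra.centralizer ℂ S)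
    (hp : IsStarProjection p) (hq : IsStarProjection q) :
    ∃ v : StarSubalgebra.centralizer ℂ S, v * star v * v = v ∧ v * p = v ∧ q * v = v ∧
      ∀ t, (q - v * star v) * t * (p - star v * v) = 0 := by
  set F : Set (Submodule ℂ (WithLp 2 (E × E))) :=
    {G | IsIsometricGraph S G ∧ ∀ x ∈ G, p.1 x.fst = x.fst ∧ q.1 x.snd = x.snd}
  obtain ⟨G, -, ⟨hG, hpq⟩, hmax⟩ := zorn_le_nonempty₀ F (fun C hCF hC G₀ hG₀ => by
      have mem : ∀ x, x ∈ sSup C ↔ ∃ G ∈ C, x ∈ G := fun x =>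
        Submodule.mem_sSup_of_directed ⟨G₀, hG₀⟩ hC.directedOn
      refine ⟨sSup C, ⟨⟨fun x hx => ?_, fun s hs x hx => ?_, fun s hs x hx => ?_⟩, fun x hx => ?_⟩,
        fun G hG => le_sSup hG⟩ <;> obtain ⟨G, hG, hx⟩ := (mem x).1 hx
      · exact (hCF hG).1.norm_eq x hx
      · exact (mem _).2 ⟨G, hG, (hCF hG).1.mem s hs x hx⟩
      · exact (mem _).2 ⟨G, hG, (hCF hG).1.adjoint_mem s hs x hx⟩
      · exact (hCF hG).2 x hx) ⊥ (by
      refine ⟨⟨?_, ?_, ?_⟩, ?_⟩ <;> intros <;> simp_all)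
  obtain ⟨v, hv, hvv, h1, h2, h3, h4⟩ := hG.exists_extension
  have hps : star p.1 = p.1 := congrArg Subtype.val hp.isSelfAdjoint.star_eq
  have hqs : star q.1 = q.1 := congrArg Subtype.val hq.isSelfAdjoint.star_eq
  have hpp : p.1 * p.1 = p.1 := congrArg Subtype.val hp.isIdempotentElem.eq
  have hqq : q.1 * q.1 = q.1 := congrArg Subtype.val hq.isIdempotentElem.eq
  have inner_symm : ∀ (a : E →L[ℂ] E) x y, ⟪a x, y⟫_ℂ = ⟪x, star a y⟫_ℂ := fun a x y =>
    (ContinuousLinearMap.adjoint_inner_right a x y).symm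
  have hvp : v * p.1 = v := by
    have : v * (1 - p.1) = 0 := ContinuousLinearMap.ext fun y => h3 _ fun x hx => by
      rw [← (hpq x hx).1, inner_symm, hps]
      change ⟪x.fst, (p.1 * (1 - p.1)) y⟫_ℂ = 0
      rw [mul_sub, mul_one, hpp, sub_self]
      simp
    rw [mul_sub, mul_one, sub_eq_zero] at this
    exact this.symm
  have hvq : star v * q.1 = star v := by
    have : star v * (1 - q.1) = 0 := ContinuousLinearMap.ext fun y => h4 _ fun x hx => by
      rw [← (hpq x hx).2, inner_symm, hqs]
      change ⟪x.snd, (q.1 * (1 - q.1)) y⟫_ℂ = 0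
      rw [mul_sub, mul_one, hqq, sub_self]
      simp
    rw [mul_sub, mul_one, sub_eq_zero] at this
    exact this.symm
  have hqv : q.1 * v = v := by simpa [hqs] using congrArg star hvq
  have hvvv : star v * (v * star v) = star v := by simpa using congrArg star hvv
  refine ⟨⟨v, hv⟩, Subtype.ext hvv, Subtype.ext hvp, Subtype.ext hqv, fun t => ?_⟩
  set T := (q - ⟨v, hv⟩ * star ⟨v, hv⟩) * t * (p - star ⟨v, hv⟩ * ⟨v, hv⟩) with hT
  have hTval : T.1 = (q.1 - v * star v) * t.1 * (p.1 - star v * v) := rfl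
  obtain ⟨a, ha, hn, G', hG', hmem⟩ := exists_abs_isIsometricGraph T.2
  have hvT : star v * T.1 = 0 := by
    rw [hTval, ← mul_assoc, ← mul_assoc, mul_sub _ q.1, hvq, hvvv, sub_self, zero_mul, zero_mul]
  have hqT : q.1 * T.1 = T.1 := by
    rw [hTval, ← mul_assoc, ← mul_assoc, mul_sub _ q.1, hqq, ← mul_assoc, hqv]
  have hTv : T.1 * star v = 0 := by
    rw [hTval, mul_assoc _ _ (star v), sub_mul p.1, mul_assoc (star v), hvvv]
    have : p.1 * star v = star v := by simpa [hps] using congrArg star hvp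
    rw [this, sub_self, mul_zero]
  have hTp : T.1 * p.1 = T.1 := by
    rw [hTval, mul_assoc _ _ p.1, sub_mul p.1, hpp, mul_assoc (star v), hvp]
  have abs_mul : ∀ b : E →L[ℂ] E, T.1 * b = 0 → a * b = 0 := fun b hb => by
    ext y
    have := DFunLike.congr_fun hb y
    exact norm_eq_zero.1 ((hn (b y)).trans (norm_eq_zero.2 this))
  have hav : a * star v = 0 := abs_mul _ hTv
  have hva : v * a = 0 := by simpa [ha] using congrArg star hav
  have hpa : p.1 * a = a := by
    have := abs_mul (1 - p.1) (by rw [mul_sub, hTp, mul_one, sub_self])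
    have := congrArg star this
    rw [star_mul, ha, star_sub, hps, star_one, star_zero, sub_mul, one_mul, sub_eq_zero] at this
    exact this.symm
  have horth : ∀ x ∈ G, ∀ y ∈ G', ⟪x.fst, y.fst⟫_ℂ = 0 ∧ ⟪x.snd, y.snd⟫_ℂ = 0 := by
    intro x hx y hy
    obtain ⟨z, hz, hz'⟩ := (hmem y).1 hy
    constructor
    · rw [← hz, ← h2 x hx, inner_symm, star_star]
      exact (congrArg _ (DFunLike.congr_fun hva z)).trans (inner_zero_right _)
    · rw [← hz', ← h1 x hx, inner_symm]
      exact (congrArg _ (DFunLike.congr_fun hvT z)).trans (inner_zero_right _)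
  have hsup : G ⊔ G' ∈ F := by
    refine ⟨⟨fun x hx => ?_, fun s hs x hx => ?_, fun s hs x hx => ?_⟩, fun x hx => ?_⟩ <;>
      obtain ⟨y, hy, z, hz, rfl⟩ := Submodule.mem_sup.1 hx
    · have e := horth y hy z hz
      have e1 := norm_add_sq_eq_norm_sq_add_norm_sq_of_inner_eq_zero _ _ e.1
      have e2 := norm_add_sq_eq_norm_sq_add_norm_sq_of_inner_eq_zero _ _ e.2
      rw [hG.norm_eq y hy, hG'.norm_eq z hz, ← e2] at e1
      exact (mul_self_inj (norm_nonneg _) (norm_nonneg _)).1 e1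
    · convert Submodule.add_mem_sup (hG.mem s hs y hy) (hG'.mem s hs z hz) using 1
      exact congrArg (WithLp.toLp 2) (Prod.ext (map_add s _ _) (map_add s _ _))
    · convert Submodule.add_mem_sup (hG.adjoint_mem s hs y hy) (hG'.adjoint_mem s hs z hz) using 1
      exact congrArg (WithLp.toLp 2) (Prod.ext (map_add (star s) _ _) (map_add (star s) _ _))
    · obtain ⟨b, hb, hb'⟩ := (hmem z).1 hz
      have e1 : p.1 z.fst = z.fst := by
        rw [← hb]
        exact DFunLike.congr_fun hpa b
      have e2 : q.1 z.snd = z.snd := by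
        rw [← hb']
        exact DFunLike.congr_fun hqT b
      simp only [WithLp.add_fst, WithLp.add_snd, map_add, hpq y hy, e1, e2, and_self]
  refine Subtype.ext (ContinuousLinearMap.ext fun y => ?_)
  have hy := h1 _ (hmax hsup le_sup_left (Submodule.mem_sup_right ((hmem
    (WithLp.toLp 2 (a y, T.1 y))).2 ⟨y, rfl, rfl⟩)))
  exact hy.symm.trans (DFunLike.congr_fun hva y)

/-- Commutants of sets of operators have a comparison theory of projections. -/
theorem isComparable_centralizer (S : Set (E →L[ℂ] E)) :
    IsComparable (StarSubalgebra.centralizer ℂ S) :=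
  ⟨centralizer_proper, centralizer_support, centralizer_polar, centralizer_maximal⟩

end Operators

section OperatorMatrices

variable {K ι : Type*} [NormedAddCommGroup K] [InnerProductSpace ℂ K] [Fintype ι]

/-- The operator on a finite Hilbert sum given by a matrix of operators. -/
noncomputable def operatorOfMatrix (A : Matrix ι ι (K →L[ℂ] K)) :
    PiLp 2 (fun _ : ι => K) →L[ℂ] PiLp 2 (fun _ : ι => K) :=
  (PiLp.continuousLinearEquiv 2 ℂ fun _ : ι => K).symm.toContinuousLinearMap ∘L
    (ContinuousLinearMap.pi fun i => ∑ j, A i j ∘L ContinuousLinearMap.proj j) ∘L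
      (PiLp.continuousLinearEquiv 2 ℂ fun _ : ι => K).toContinuousLinearMap

@[simp]
theorem operatorOfMatrix_apply (A : Matrix ι ι (K →L[ℂ] K)) (x : PiLp 2 fun _ : ι => K) (i : ι) :
    operatorOfMatrix A x i = ∑ j, A i j (x j) := by
  simp [operatorOfMatrix]

theorem operatorOfMatrix_mul (A B : Matrix ι ι (K →L[ℂ] K)) :
    operatorOfMatrix (A * B) = operatorOfMatrix A * operatorOfMatrix B := by
  ext x i
  rw [mul_apply_eq_comp]
  simp only [operatorOfMatrix_apply, Matrix.mul_apply, sum_apply,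
    mul_apply_eq_comp, map_sum]
  exact Finset.sum_comm

theorem operatorOfMatrix_add (A B : Matrix ι ι (K →L[ℂ] K)) :
    operatorOfMatrix (A + B) = operatorOfMatrix A + operatorOfMatrix B := by
  ext x i
  simp [Finset.sum_add_distrib]

theorem operatorOfMatrix_star [CompleteSpace K] (A : Matrix ι ι (K →L[ℂ] K)) :
    operatorOfMatrix (star A) = star (operatorOfMatrix A) := by
  rw [ContinuousLinearMap.star_eq_adjoint, ContinuousLinearMap.eq_adjoint_iff]
  intro x y
  simp only [PiLp.inner_apply, operatorOfMatrix_apply, sum_inner, inner_sum, Matrix.star_apply,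
    ContinuousLinearMap.star_eq_adjoint, ContinuousLinearMap.adjoint_inner_left]
  exact Finset.sum_comm

variable [DecidableEq ι]

theorem operatorOfMatrix_injective :
    Function.Injective (operatorOfMatrix : Matrix ι ι (K →L[ℂ] K) → _) := by
  intro A B h
  ext i j x
  have := congrArg (fun T => T (WithLp.toLp 2 (Pi.single j x)) i) h
  simpa [Pi.single_apply, apply_ite] using this

theorem operatorOfMatrix_surjective :
    Function.Surjective (operatorOfMatrix : Matrix ι ι (K →L[ℂ] K) → _) := by
  intro T
  refine ⟨Matrix.of fun i j => ContinuousLinearMap.proj i ∘L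
    (PiLp.continuousLinearEquiv 2 ℂ fun _ : ι => K).toContinuousLinearMap ∘L T ∘L
      (PiLp.continuousLinearEquiv 2 ℂ fun _ : ι => K).symm.toContinuousLinearMap ∘L
        ContinuousLinearMap.single ℂ (fun _ : ι => K) j, ?_⟩
  ext x i
  have hx : x = ∑ j, WithLp.toLp 2 (Pi.single j (x j)) := by
    ext k
    simp [Pi.single_apply]
  rw [operatorOfMatrix_apply]
  calc _ = ∑ j, T (WithLp.toLp 2 (Pi.single j (x j))) i := rfl
    _ = (∑ j, T (WithLp.toLp 2 (Pi.single j (x j)))) i := by simp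
    _ = T x i := by rw [← map_sum, ← hx]

/-- Matrices of operators act on the finite Hilbert sum. -/
noncomputable def operatorOfMatrixEquiv [CompleteSpace K] : Matrix ι ι (K →L[ℂ] K) ≃⋆+*
    (PiLp 2 (fun _ : ι => K) →L[ℂ] PiLp 2 (fun _ : ι => K)) :=
  { Equiv.ofBijective operatorOfMatrix ⟨operatorOfMatrix_injective, operatorOfMatrix_surjective⟩ with
    map_mul' := operatorOfMatrix_mul
    map_add' := operatorOfMatrix_add
    map_star' := operatorOfMatrix_star }

end OperatorMatrices

namespace Matrix

theorem commute_diagonal_const_iff {R ι : Type*} [Semiring R] [Fintype ι] [DecidableEq ι] {b : R}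
    {A : Matrix ι ι R} :
    (diagonal fun _ => b) * A = A * (diagonal fun _ => b) ↔ ∀ i j, b * A i j = A i j * b := by
  simp [← Matrix.ext_iff]

theorem commute_diagonal_const_single {R ι : Type*} [Ring R] [Fintype ι] [DecidableEq ι] (r : R)
    (i j : ι) : Commute (diagonal fun _ => r) (single i j (1 : R)) :=
  ((mem_range_scalar_iff_commute_single' (M := scalar ι r)).1 ⟨r, rfl⟩ i j).symm

theorem diagonal_const_injective {R ι : Type*} [Zero R] [DecidableEq ι] [Nonempty ι] {a b : R}
    (h : (diagonal fun _ : ι => a) = diagonal fun _ => b) : a = b :=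
  diagonal_injective.comp Function.const_injective h

theorem isMatrixUnits_single {R ι : Type*} [Ring R] [StarRing R] [Fintype ι] [DecidableEq ι] :
    IsMatrixUnits fun i j : ι => single i j (1 : R) := by
  constructor
  · intro i j
    rw [star_eq_conjTranspose, conjTranspose_single, star_one]
  · intro i j k
    rw [single_mul_single_same, one_mul]
  · intro i j k l h
    rw [single_mul_single_of_ne _ _ _ _ h]

theorem exists_map_diagonal_const {A B ι : Type*} [Ring A] [Ring B] [Fintype ι] [DecidableEq ι]
    (Φ : Matrix ι ι A →+* Matrix ι ι B) (h : ∀ i j, Φ (single i j 1) = single i j 1) (a : A) :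
    ∃ b, Φ (diagonal fun _ => a) = diagonal fun _ => b := by
  obtain ⟨b, hb⟩ := mem_range_scalar_iff_commute_single'.2 fun i j => by
    have := (commute_diagonal_const_single a i j).symm.map Φ
    rwa [h] at this
  exact ⟨b, hb.symm⟩

/-- A star isomorphism of matrix algebras fixing the matrix units acts entrywise. -/
theorem exists_starAlgEquiv_of_map_single {A B ι : Type*} [Ring A] [StarRing A] [Algebra ℂ A]
    [Ring B] [StarRing B] [Algebra ℂ B] [Fintype ι] [DecidableEq ι] [Nonempty ι]
    (Ψ : Matrix ι ι A ≃⋆ₐ[ℂ] Matrix ι ι B) (h : ∀ i j, Ψ (single i j 1) = single i j 1) :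
    ∃ ρ : A ≃⋆ₐ[ℂ] B, ∀ a, Ψ (diagonal fun _ => a) = diagonal fun _ => ρ a := by
  choose φ hφ using exists_map_diagonal_const (RingHomClass.toRingHom Ψ) h
  choose ψ hψ using exists_map_diagonal_const (RingHomClass.toRingHom Ψ.symm)
    fun i j => by simp [← h]
  replace hφ : ∀ a, Ψ (diagonal fun _ => a) = diagonal fun _ => φ a := hφ
  replace hψ : ∀ b, Ψ.symm (diagonal fun _ => b) = diagonal fun _ => ψ b := hψ
  have hψφ : ∀ a, ψ (φ a) = a := fun a => diagonal_const_injective (ι := ι) <| by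
    rw [← hψ, ← hφ, StarAlgEquiv.symm_apply_apply]
  have hφψ : ∀ b, φ (ψ b) = b := fun b => diagonal_const_injective (ι := ι) <| by
    rw [← hφ, ← hψ, StarAlgEquiv.apply_symm_apply]
  refine ⟨{ toFun := φ
            invFun := ψ
            left_inv := hψφ
            right_inv := hφψ
            map_mul' := fun a b => diagonal_const_injective (ι := ι) ?_
            map_add' := fun a b => diagonal_const_injective (ι := ι) ?_
            map_star' := fun a => diagonal_const_injective (ι := ι) ?_
            map_smul' := fun c a => diagonal_const_injective (ι := ι) ?_ }, hφ⟩
  · rw [← hφ, ← diagonal_mul_diagonal, map_mul, hφ, hφ, diagonal_mul_diagonal]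
  · rw [← hφ, ← diagonal_add, map_add, hφ, hφ, diagonal_add]
  · have := map_star Ψ (diagonal fun _ => a)
    rw [hφ, star_eq_conjTranspose, star_eq_conjTranspose, diagonal_conjTranspose,
      diagonal_conjTranspose] at this
    exact (hφ _).symm.trans this
  · have := map_smul Ψ c (diagonal fun _ => a)
    rw [hφ, ← diagonal_smul, ← diagonal_smul] at this
    exact (hφ _).symm.trans this

end Matrix

theorem IsMatrixUnits.exists_unitary {R ι : Type*} [Ring R] [StarRing R] [Fintype ι]
    [DecidableEq ι] [Nonempty ι] (hR : IsComparable R) {e f : ι → ι → R} (he : IsMatrixUnits e)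
    (hf : IsMatrixUnits f) (he1 : ∑ i, e i i = 1) (hf1 : ∑ i, f i i = 1) :
    ∃ u ∈ unitary R, ∀ i j, u * e i j = f i j * u := by
  obtain ⟨o⟩ := ‹Nonempty ι›
  obtain ⟨y, hy, hy'⟩ := he.exists_equiv hR hf he1 hf1 o
  have hs : star (∑ i, f i o * y * e o i) = ∑ i, e i o * star y * f o i := by
    simp [star_sum, he.star_eq, hf.star_eq, mul_assoc]
  refine ⟨∑ i, f i o * y * e o i, Unitary.mem_iff.2 ⟨?_, ?_⟩, fun i j => ?_⟩
  · rw [hs, Finset.sum_mul_sum, ← he1]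
    refine Finset.sum_congr rfl fun i _ => ?_
    rw [Finset.sum_eq_single i]
    · calc _ = e i o * star y * (f o i * f i o) * y * e o i := by noncomm_ring
        _ = e i o * (star y * y) * (star y * y) * e o i := by
          rw [hf.mul_same, ← hy']; noncomm_ring
        _ = e i i := by simp only [hy, he.mul_same]
    · intro j _ hj
      calc _ = e i o * star y * (f o i * f j o) * y * e o j := by noncomm_ring
        _ = 0 := by rw [hf.mul_ne _ _ hj.symm]; simp
    · simp
  · rw [hs, Finset.sum_mul_sum, ← hf1]
    refine Finset.sum_congr rfl fun i _ => ?_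
    rw [Finset.sum_eq_single i]
    · calc _ = f i o * y * (e o i * e i o) * star y * f o i := by noncomm_ring
        _ = f i o * (y * star y) * (y * star y) * f o i := by
          rw [he.mul_same, ← hy]; noncomm_ring
        _ = f i i := by simp only [hy', hf.mul_same]
    · intro j _ hj
      calc _ = f i o * y * (e o i * e j o) * star y * f o j := by noncomm_ring
        _ = 0 := by rw [he.mul_ne _ _ hj.symm]; simp
    · simp
  · rw [Finset.sum_mul, Finset.mul_sum, Finset.sum_eq_single i, Finset.sum_eq_single j]
    · rw [mul_assoc, he.mul_same, ← mul_assoc, ← mul_assoc, hf.mul_same]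
    · intro k _ hk
      rw [← mul_assoc, ← mul_assoc, hf.mul_ne _ _ hk.symm, zero_mul, zero_mul]
    · simp
    · intro k _ hk
      rw [mul_assoc, he.mul_ne _ _ hk, mul_zero]
    · simp

/-- The representation of matrices over a von Neumann algebra on the finite Hilbert sum. -/
noncomputable def VonNeumannAlgebra.matrixRep {K ι : Type*} [NormedAddCommGroup K]
    [InnerProductSpace ℂ K] [CompleteSpace K] [Fintype ι] [DecidableEq ι]
    (N : VonNeumannAlgebra K) : Matrix ι ι N.toStarSubalgebra →+*
      (PiLp 2 (fun _ : ι => K) →L[ℂ] PiLp 2 (fun _ : ι => K)) :=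
  (RingHomClass.toRingHom (operatorOfMatrixEquiv (K := K) (ι := ι))).comp
    (RingHomClass.toRingHom N.toStarSubalgebra.subtype).mapMatrix

namespace VonNeumannAlgebra

variable {K ι : Type*} [NormedAddCommGroup K] [InnerProductSpace ℂ K] [CompleteSpace K] [Fintype ι]
  [DecidableEq ι] (N : VonNeumannAlgebra K)

theorem matrixRep_apply (A : Matrix ι ι N.toStarSubalgebra) :
    N.matrixRep A = operatorOfMatrix (A.map Subtype.val) := rfl

theorem matrixRep_injective : Function.Injective (N.matrixRep (ι := ι)) :=
  operatorOfMatrix_injective.comp (Matrix.map_injective Subtype.val_injective)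

theorem matrixRep_star (A : Matrix ι ι N.toStarSubalgebra) :
    N.matrixRep (star A) = star (N.matrixRep A) := by
  rw [matrixRep_apply, matrixRep_apply, ← operatorOfMatrix_star]
  rfl

/-- The operators on the finite Hilbert sum commuting with the amplification of `y`, of its
adjoint and of the commutant of `N`. -/
noncomputable def amplificationCommutant (ι : Type*) [Fintype ι] [DecidableEq ι]
    (y : N.toStarSubalgebra) :
    StarSubalgebra ℂ (PiLp 2 (fun _ : ι => K) →L[ℂ] PiLp 2 (fun _ : ι => K)) :=
  StarSubalgebra.centralizer ℂ
    ((fun b => operatorOfMatrix (Matrix.diagonal fun _ => b)) '' insert (y : K →L[ℂ] K) N.commutant)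

theorem operatorOfMatrix_mem_amplificationCommutant_iff {y : N.toStarSubalgebra}
    {A : Matrix ι ι (K →L[ℂ] K)} : operatorOfMatrix A ∈ N.amplificationCommutant ι y ↔
      ∀ i j, (y * A i j = A i j * y ∧ star (y : K →L[ℂ] K) * A i j = A i j * star y.1) ∧
        A i j ∈ N := by
  have hmem (a : K →L[ℂ] K) : a ∈ N ↔ ∀ b ∈ N.commutant, b * a = a * b := by
    rw [← N.commutant_commutant, mem_commutant_iff, commutant_commutant]
  have hstar {b : K →L[ℂ] K} : star (operatorOfMatrix (Matrix.diagonal fun _ : ι => b)) =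
      operatorOfMatrix (Matrix.diagonal fun _ => star b) := by
    rw [← operatorOfMatrix_star, Matrix.star_eq_conjTranspose, Matrix.diagonal_conjTranspose]
    rfl
  rw [amplificationCommutant, StarSubalgebra.mem_centralizer_iff ℂ, Set.forall_mem_image]
  simp only [hstar, ← operatorOfMatrix_mul, operatorOfMatrix_injective.eq_iff,
    Matrix.commute_diagonal_const_iff, hmem, Set.forall_mem_insert]
  refine ⟨fun h i j => ⟨⟨h.1.1 i j, h.1.2 i j⟩, fun b hb => (h.2 b hb).1 i j⟩, fun h =>
    ⟨⟨fun i j => (h i j).1.1, fun i j => (h i j).1.2⟩, fun b hb => ⟨fun i j => (h i j).2 b hb,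
      fun i j => (h i j).2 _ (star_mem hb)⟩⟩⟩

theorem matrixRep_mem_amplificationCommutant_iff {y : N.toStarSubalgebra}
    {A : Matrix ι ι N.toStarSubalgebra} : N.matrixRep A ∈ N.amplificationCommutant ι y ↔
      Commute (Matrix.diagonal fun _ => y) A ∧ Commute (Matrix.diagonal fun _ => y) (star A) := by
  rw [matrixRep_apply, operatorOfMatrix_mem_amplificationCommutant_iff]
  simp only [commute_iff_eq, Matrix.commute_diagonal_const_iff, Matrix.star_apply]
  refine ⟨fun h => ⟨fun i j => Subtype.ext (h i j).1.1, fun i j => star_injective ?_⟩,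
    fun h i j => ⟨⟨congrArg Subtype.val (h.1 i j), ?_⟩, (A i j).2⟩⟩
  · rw [star_mul, star_mul, star_star]
    exact (Subtype.ext (h j i).1.2).symm
  · have := congrArg star (h.2 j i)
    rw [star_mul, star_mul, star_star] at this
    exact (congrArg Subtype.val this).symm

theorem exists_unitary_conj {y : N.toStarSubalgebra} [Nonempty ι]
    {e f : ι → ι → Matrix ι ι N.toStarSubalgebra} (he : IsMatrixUnits e) (hf : IsMatrixUnits f)
    (he1 : ∑ i, e i i = 1) (hf1 : ∑ i, f i i = 1)
    (hey : ∀ i j, Commute (Matrix.diagonal fun _ => y) (e i j))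
    (hfy : ∀ i j, Commute (Matrix.diagonal fun _ => y) (f i j)) :
    ∃ u ∈ unitary (Matrix ι ι N.toStarSubalgebra),
      (∀ i j, u * e i j = f i j * u) ∧ Commute (Matrix.diagonal fun _ => y) u := by
  have key : ∀ {g : ι → ι → Matrix ι ι N.toStarSubalgebra}, IsMatrixUnits g →
      (∑ i, g i i = 1) → (∀ i j, Commute (Matrix.diagonal fun _ => y) (g i j)) →
      ∃ g' : ι → ι → N.amplificationCommutant ι y, IsMatrixUnits g' ∧ ∑ i, g' i i = 1 ∧
        ∀ i j, (g' i j).1 = N.matrixRep (g i j) := by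
    intro g hg hg1 hgy
    refine ⟨fun i j => ⟨N.matrixRep (g i j),
      N.matrixRep_mem_amplificationCommutant_iff.2 ⟨hgy i j, hg.star_eq i j ▸ hgy j i⟩⟩,
      ⟨fun i j => Subtype.ext ?_, fun i j k => Subtype.ext ?_, fun i j k l h => Subtype.ext ?_⟩,
      Subtype.ext ?_, fun i j => rfl⟩
    · exact (N.matrixRep_star _).symm.trans (congrArg _ (hg.star_eq i j))
    · exact (map_mul _ _ _).symm.trans (congrArg _ (hg.mul_same i j k))
    · exact (map_mul _ _ _).symm.trans ((congrArg _ (hg.mul_ne i l h)).trans (map_zero _))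
    · simp [← map_sum, hg1]
  obtain ⟨e', he', he1', hee⟩ := key he he1 hey
  obtain ⟨f', hf', hf1', hff⟩ := key hf hf1 hfy
  obtain ⟨⟨u', hu'⟩, hu1, hu⟩ :=
    IsMatrixUnits.exists_unitary (isComparable_centralizer _) he' hf' he1' hf1'
  obtain ⟨A, rfl⟩ := operatorOfMatrix_surjective u'
  have hA := N.operatorOfMatrix_mem_amplificationCommutant_iff.1 hu'
  set u : Matrix ι ι N.toStarSubalgebra := Matrix.of fun i j => ⟨A i j, (hA i j).2⟩ with hudef
  have hrep : N.matrixRep u = operatorOfMatrix A := rfl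
  rw [← hrep] at hu'
  refine ⟨u, Unitary.mem_iff.2 ⟨N.matrixRep_injective ?_, N.matrixRep_injective ?_⟩,
    fun i j => N.matrixRep_injective ?_,
    (N.matrixRep_mem_amplificationCommutant_iff.1 hu').1⟩
  · rw [map_mul, map_one, matrixRep_star]
    exact congrArg Subtype.val (Unitary.mem_iff.1 hu1).1
  · rw [map_mul, map_one, matrixRep_star]
    exact congrArg Subtype.val (Unitary.mem_iff.1 hu1).2
  · rw [map_mul, map_mul, ← hee, ← hff]
    exact congrArg Subtype.val (hu i j)

end VonNeumannAlgebra

/-- cancellation for finite amplifications: If a *-isomorphism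
`M_n(ℂ) ⊗̄ M ≅ M_n(ℂ) ⊗̄ N` (encoded as matrix algebras over the von Neumann algebras,
since `n` is finite) carries `1 ⊗ x` to `1 ⊗ y`, then there is a *-isomorphism `M ≅ N`
carrying `x` to `y`. -/
theorem stmt15 {H K : Type*}
    [NormedAddCommGroup H] [InnerProductSpace ℂ H] [CompleteSpace H]
    [NormedAddCommGroup K] [InnerProductSpace ℂ K] [CompleteSpace K]
    (M : VonNeumannAlgebra H) (N : VonNeumannAlgebra K)
    (n : ℕ) (hn : 2 ≤ n) (x : M.toStarSubalgebra) (y : N.toStarSubalgebra)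
    (π : Matrix (Fin n) (Fin n) M.toStarSubalgebra ≃⋆ₐ[ℂ]
      Matrix (Fin n) (Fin n) N.toStarSubalgebra)
    (hπ : π (Matrix.diagonal fun _ => x) = Matrix.diagonal fun _ => y) :
    ∃ ρ : M.toStarSubalgebra ≃⋆ₐ[ℂ] N.toStarSubalgebra, ρ x = y := by
  have : NeZero n := ⟨by lia⟩
  have he := Matrix.isMatrixUnits_single (R := M.toStarSubalgebra) (ι := Fin n)
  obtain ⟨u, hu1, hu, huy⟩ := N.exists_unitary_conj (y := y)
    (f := fun i j => π (Matrix.single i j 1)) Matrix.isMatrixUnits_single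
    ⟨fun i j => by rw [← map_star, he.star_eq], fun i j k => by rw [← map_mul, he.mul_same],
      fun i j k l h => by rw [← map_mul, he.mul_ne i l h, map_zero]⟩
    Matrix.sum_single_one
    (by rw [← map_sum, Matrix.sum_single_one, map_one])
    (Matrix.commute_diagonal_const_single y)
    fun i j => hπ ▸ (Matrix.commute_diagonal_const_single x i j).map π
  have hu2 : star u * u = 1 := (Unitary.mem_iff.1 hu1).1
  obtain ⟨ρ, hρ⟩ := Matrix.exists_starAlgEquiv_of_map_single
    (π.trans (Unitary.conjStarAlgAut ℂ _ (star ⟨u, hu1⟩))) fun i j => by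
      rw [StarAlgEquiv.trans_apply, Unitary.conjStarAlgAut_star_apply]
      exact (mul_assoc _ _ _).trans
        ((congrArg _ (hu i j).symm).trans (by rw [← mul_assoc, hu2, one_mul]))
  refine ⟨ρ, Matrix.diagonal_const_injective (ι := Fin n) ((hρ x).symm.trans ?_)⟩
  rw [StarAlgEquiv.trans_apply, hπ, Unitary.conjStarAlgAut_star_apply]
  exact (mul_assoc _ _ _).trans ((congrArg _ huy.eq).trans (by rw [← mul_assoc, hu2, one_mul]))
end
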